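/- arXiv:2310.05226 — 12 statements merged into one kernel-verified Lean document; each statement's English description precedes it below -/
import Mathlib

section
/- The pair (U, V) is a traveling-band solution of the reduced chemotaxis system with unlimited substrate in the borderline case d = 1: for every ζ ∈ ℝ one has τ c U′(ζ) − (μ/2) (U·V′/V)′(ζ) + (μ/2) U″(ζ) = 0 and c V′(ζ) − k U(ζ) = 0. -/
open Real Filter

/-- The pair (U, V) is a traveling-band solution of the reduced chemotaxis system
with unlimited substrate in the borderline case d = 1 (β = μ/2). -/
theorem unlimited_substrate_traveling_band_d_eq_one
    (τ μ k c Vinf C0 : ℝ)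
    (hτ : 0 < τ) (hμ : 0 < μ) (hk : 0 < k) (hc : 0 < c)
    (hVinf : 0 < Vinf) (hC0 : 0 < C0)
    (V U : ℝ → ℝ)
    (hV : ∀ ζ : ℝ, V ζ =
      Vinf * Real.exp (-(C0 * k * μ / (2 * c ^ 2 * τ)) * Real.exp (-(2 * τ * c * ζ) / μ)))
    (hU : ∀ ζ : ℝ, U ζ = C0 * V ζ * Real.exp (-(2 * τ * c * ζ) / μ)) :
    ∀ ζ : ℝ,
      τ * c * deriv U ζ - μ / 2 * deriv (fun s => U s * deriv V s / V s) ζ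
          + μ / 2 * deriv (deriv U) ζ = 0 ∧
      c * deriv V ζ - k * U ζ = 0 := by
  have hE : ∀ x : ℝ, HasDerivAt (fun ζ : ℝ => Real.exp (-(2 * τ * c * ζ) / μ))
      (-(2 * τ * c / μ) * Real.exp (-(2 * τ * c * x) / μ)) x := by
    intro x
    have h1 : HasDerivAt (fun ζ : ℝ => -(2 * τ * c * ζ) / μ) (-(2 * τ * c * 1) / μ) x :=
      (((hasDerivAt_id x).const_mul (2 * τ * c)).neg).div_const μ
    refine h1.exp.congr_deriv ?_
    ring
  have hVpos : ∀ x, V x ≠ 0 := by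
    intro x
    rw [hV]
    positivity
  have hVd : ∀ x, HasDerivAt V (k / c * U x) x := by
    intro x
    have h := (((hE x).const_mul (-(C0 * k * μ / (2 * c ^ 2 * τ)))).exp).const_mul Vinf
    rw [← funext hV] at h
    refine h.congr_deriv ?_
    rw [hU, hV]
    field_simp
  have hUd : ∀ x, HasDerivAt U
      (U x * (k * C0 / c * Real.exp (-(2 * τ * c * x) / μ) - 2 * τ * c / μ)) x := by
    intro x
    have h := ((hVd x).const_mul C0).mul (hE x)
    have e : U = (fun y => C0 * V y) * (fun ζ : ℝ => Real.exp (-(2 * τ * c * ζ) / μ)) :=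
      funext hU
    rw [← e] at h
    refine h.congr_deriv ?_
    rw [hU]
    ring
  have hdV : deriv V = fun x => k / c * U x := funext fun x => (hVd x).deriv
  have hdU : deriv U = fun x =>
      U x * (k * C0 / c * Real.exp (-(2 * τ * c * x) / μ) - 2 * τ * c / μ) :=
    funext fun x => (hUd x).deriv
  have hdUd : ∀ x, DifferentiableAt ℝ (deriv U) x := by
    intro x
    rw [hdU]
    exact (hUd x).differentiableAt.mul
      (((hE x).differentiableAt.const_mul _).sub_const _)
  have hf : (fun s => U s * deriv V s / V s) = fun s => deriv U s + 2 * τ * c / μ * U s := by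
    funext s
    have := hVpos s
    rw [hdV, hdU]
    simp only
    rw [hU s]
    field_simp
    ring
  intro ζ
  constructor
  · have h := ((hdUd ζ).hasDerivAt.add ((hUd ζ).differentiableAt.hasDerivAt.const_mul
      (2 * τ * c / μ))).deriv
    have h' : deriv (fun s => U s * deriv V s / V s) ζ
        = deriv (deriv U) ζ + 2 * τ * c / μ * deriv U ζ := by
      rw [hf]; exact h
    rw [h']
    field_simp
    ring
  · rw [hdV]
    field_simp
    ring
end

section
/- The traveling-band profiles vanish at −∞: U(ζ) → 0 and V(ζ) → 0 as ζ → −∞. -/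
open Real Filter

/-- The traveling-band profiles vanish at −∞: U(ζ) → 0 and V(ζ) → 0 as ζ → −∞. -/
theorem unlimited_substrate_band_conditions_at_bot
    (τ β μ k c Vinf C0 d : ℝ)
    (hτ : 0 < τ) (hβ : 0 < β) (hμ : 0 < μ) (hk : 0 < k) (hc : 0 < c)
    (hVinf : 0 < Vinf) (hC0 : 0 < C0)
    (hd : d = 2 * β / μ) (hd1 : 1 < d)
    (V U : ℝ → ℝ)
    (hV : ∀ ζ : ℝ, V ζ =
      ((C0 * k * μ * (d - 1)) / (2 * c ^ 2 * τ) * Real.exp (-(2 * τ * c * ζ) / μ)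
        + Vinf ^ (-(d - 1))) ^ (-(1 / (d - 1))))
    (hU : ∀ ζ : ℝ, U ζ = C0 * V ζ ^ d * Real.exp (-(2 * τ * c * ζ) / μ)) :
    Tendsto U atBot (nhds 0) ∧ Tendsto V atBot (nhds 0) := by
  have hd0 : 0 < d - 1 := by linarith
  have hA : 0 < (C0 * k * μ * (d - 1)) / (2 * c ^ 2 * τ) := by positivity
  have hB : 0 < Vinf ^ (-(d - 1)) := Real.rpow_pos_of_pos hVinf _
  generalize (C0 * k * μ * (d - 1)) / (2 * c ^ 2 * τ) = A at hV hA
  generalize Vinf ^ (-(d - 1)) = B at hV hB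
  have hE : Tendsto (fun ζ : ℝ => Real.exp (-(2 * τ * c * ζ) / μ)) atBot atTop := by
    apply Real.tendsto_exp_atTop.comp
    have h : (0 : ℝ) < 2 * τ * c / μ := by positivity
    have h2 := (tendsto_neg_atBot_atTop (G := ℝ)).const_mul_atTop h
    refine h2.congr ?_
    intro x
    ring
  have hW : Tendsto (fun ζ : ℝ => A * Real.exp (-(2 * τ * c * ζ) / μ) + B) atBot atTop :=
    tendsto_atTop_add_const_right _ _ (hE.const_mul_atTop hA)
  have hVt : Tendsto V atBot (nhds 0) := by
    have h := (tendsto_rpow_neg_atTop (y := 1 / (d - 1)) (by positivity)).comp hW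
    refine h.congr ?_
    intro x
    rw [hV x]
    rfl
  refine ⟨?_, hVt⟩
  have hb : Tendsto (fun ζ => C0 / A * V ζ) atBot (nhds 0) := by
    simpa using hVt.const_mul (C0 / A)
  have key : ∀ ζ, 0 ≤ U ζ ∧ U ζ ≤ C0 / A * V ζ := by
    intro ζ
    have hVz := hV ζ
    rw [hU ζ]
    have hEp := Real.exp_pos (-(2 * τ * c * ζ) / μ)
    generalize Real.exp (-(2 * τ * c * ζ) / μ) = E at hVz hEp ⊢
    have hWp : 0 < A * E + B := by positivity
    have hVp : 0 < V ζ := by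
      rw [hVz]
      exact Real.rpow_pos_of_pos hWp _
    have h1 : V ζ ^ (d - 1) = (A * E + B)⁻¹ := by
      rw [hVz, ← Real.rpow_mul hWp.le, ← Real.rpow_neg_one]
      congr 1
      field_simp
    have h2 : V ζ ^ d = V ζ * (A * E + B)⁻¹ := by
      rw [← h1, mul_comm, ← Real.rpow_add_one hVp.ne']
      congr 1
      ring
    refine ⟨by positivity, ?_⟩
    rw [h2]
    have h3 : (A * E + B)⁻¹ * E ≤ 1 / A := by
      rw [inv_mul_eq_div, div_le_div_iff₀ hWp hA]
      nlinarith
    calc C0 * (V ζ * (A * E + B)⁻¹) * E = C0 * V ζ * ((A * E + B)⁻¹ * E) := by ring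
      _ ≤ C0 * V ζ * (1 / A) := by gcongr
      _ = C0 / A * V ζ := by ring
  exact squeeze_zero (fun ζ => (key ζ).1) (fun ζ => (key ζ).2) hb
end

section
/- The band speed formula holds: the profile U is integrable on ℝ and c = (k/V∞) · ∫_{−∞}^{∞} U(ζ) dζ, i.e. ∫_{−∞}^{∞} U(ζ) dζ = c·V∞/k. -/
open Real Filter MeasureTheory

/-- The band speed formula: U is integrable on ℝ and ∫ U = c·V∞/k. -/
theorem unlimited_substrate_band_speed
    (τ β μ k c Vinf C0 d : ℝ)
    (hτ : 0 < τ) (hβ : 0 < β) (hμ : 0 < μ) (hk : 0 < k) (hc : 0 < c)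
    (hVinf : 0 < Vinf) (hC0 : 0 < C0)
    (hd : d = 2 * β / μ) (hd1 : 1 < d)
    (V U : ℝ → ℝ)
    (hV : ∀ ζ : ℝ, V ζ =
      ((C0 * k * μ * (d - 1)) / (2 * c ^ 2 * τ) * Real.exp (-(2 * τ * c * ζ) / μ)
        + Vinf ^ (-(d - 1))) ^ (-(1 / (d - 1))))
    (hU : ∀ ζ : ℝ, U ζ = C0 * V ζ ^ d * Real.exp (-(2 * τ * c * ζ) / μ)) :
    Integrable U ∧ c = (k / Vinf) * ∫ ζ : ℝ, U ζ := by
  have hd0 : 0 < d - 1 := by linarith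
  obtain ⟨A, hA⟩ : ∃ A, A = (C0 * k * μ * (d - 1)) / (2 * c ^ 2 * τ) := ⟨_, rfl⟩
  have hApos : 0 < A := by rw [hA]; positivity
  obtain ⟨B, hB⟩ : ∃ B, B = Vinf ^ (-(d - 1)) := ⟨_, rfl⟩
  have hBpos : 0 < B := by rw [hB]; positivity
  obtain ⟨a, ha⟩ : ∃ a, a = 2 * τ * c / μ := ⟨_, rfl⟩
  have hapos : 0 < a := by rw [ha]; positivity
  have harg : ∀ ζ, -(2 * τ * c * ζ) / μ = -(a * ζ) := by intro ζ; rw [ha]; ring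
  simp only [← hA, ← hB, harg] at hV hU
  have hWpos : ∀ ζ, 0 < A * Real.exp (-(a * ζ)) + B := fun ζ => by positivity
  have hVpos : ∀ ζ, 0 < V ζ := fun ζ => by rw [hV]; exact Real.rpow_pos_of_pos (hWpos ζ) _
  have hUpos : ∀ ζ, 0 ≤ U ζ := fun ζ => by
    rw [hU]; have := Real.rpow_pos_of_pos (hVpos ζ) d; positivity
  have hVfun : V = fun ζ => (A * Real.exp (-(a * ζ)) + B) ^ (-(1 / (d - 1))) := funext hV
  have hder : ∀ ζ, HasDerivAt (fun ζ => c / k * V ζ) (U ζ) ζ := by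
    intro ζ
    have h1 : HasDerivAt (fun ζ => A * Real.exp (-(a * ζ)) + B)
        (A * (Real.exp (-(a * ζ)) * (-(a * 1)))) ζ :=
      ((((hasDerivAt_id ζ).const_mul a).neg.exp).const_mul A).add_const B
    have h2 := (h1.rpow_const (p := -(1 / (d - 1))) (Or.inl (hWpos ζ).ne')).const_mul (c / k)
    rw [hVfun]
    refine h2.congr_deriv (Eq.symm ?_)
    rw [hU, hV, ← Real.rpow_mul (hWpos ζ).le]
    have e : -(1 / (d - 1)) * d = -(1 / (d - 1)) - 1 := by field_simp; ring
    rw [e]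
    have e2 : C0 = c / k * (A * a * (1 / (d - 1))) := by
      rw [hA, ha]; field_simp
    generalize (A * Real.exp (-(a * ζ)) + B) ^ (-(1 / (d - 1)) - 1) = X
    rw [e2]; ring
  have htop : Tendsto (fun ζ => c / k * V ζ) atTop (nhds (c / k * Vinf)) := by
    have h1 : Tendsto (fun ζ => A * Real.exp (-(a * ζ)) + B) atTop (nhds (A * 0 + B)) := by
      refine Tendsto.add_const B (Tendsto.const_mul A ?_)
      exact Real.tendsto_exp_neg_atTop_nhds_zero.comp (tendsto_id.const_mul_atTop hapos)
    rw [mul_zero, zero_add] at h1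
    have h2 := h1.rpow_const (p := -(1 / (d - 1))) (Or.inl hBpos.ne')
    have e : B ^ (-(1 / (d - 1))) = Vinf := by
      rw [hB, ← Real.rpow_mul hVinf.le]
      have : -(d - 1) * -(1 / (d - 1)) = 1 := by field_simp
      rw [this, Real.rpow_one]
    rw [e] at h2
    rw [hVfun]
    exact h2.const_mul _
  have hbot : Tendsto (fun ζ => c / k * V ζ) atBot (nhds 0) := by
    have h1 : Tendsto (fun ζ => A * Real.exp (-(a * ζ)) + B) atBot atTop := by
      refine tendsto_atTop_add_const_right _ B (Tendsto.const_mul_atTop hApos ?_)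
      exact Real.tendsto_exp_atTop.comp
        (tendsto_neg_atBot_atTop.comp (tendsto_id.const_mul_atBot hapos))
    have h2 := (tendsto_rpow_neg_atTop (y := 1 / (d - 1)) (by positivity)).comp h1
    rw [hVfun]
    simpa using h2.const_mul (c / k)
  have hint : Integrable U := by
    have i1 : IntegrableOn U (Set.Ioi 0) :=
      integrableOn_Ioi_deriv_of_nonneg' (fun x _ => hder x) (fun x _ => hUpos x) htop
    have i2 : IntegrableOn (fun x => U (-x)) (Set.Ioi 0) := by
      refine integrableOn_Ioi_deriv_of_nonneg' (g := fun x => -(c / k * V (-x))) (fun x _ => ?_)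
        (fun x _ => hUpos _) (hbot.comp tendsto_neg_atTop_atBot).neg
      have := ((hder (-x)).scomp x (hasDerivAt_neg x)).neg
      exact this.congr_deriv (by simp)
    have i3 : IntegrableOn U (Set.Iic 0) := by
      rw [integrableOn_Iic_iff_integrableOn_Iio]
      simpa using i2.comp_neg
    rw [← integrableOn_univ, ← Set.Iic_union_Ioi (a := (0 : ℝ))]
    exact i3.union i1
  refine ⟨hint, ?_⟩
  rw [integral_of_hasDerivAt_of_tendsto hder hint hbot htop]
  field_simp
  ring
end

section
/- The substrate profile V is Lipschitz in the parameters uniformly in ζ: for any compact set Ω ⊂ 𝔻 there exists K > 0 such that for all parameter vectors W₁, W₂ ∈ Ω and all ζ ∈ ℝ, |V(ζ, W₁) − V(ζ, W₂)| ≤ K·|W₁ − W₂|. -/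
open Real Filter

lemma aux_x_exp (δ x : ℝ) (hδ : 0 < δ) : x * Real.exp (-(δ * x)) ≤ 1 / δ := by
  rw [Real.exp_neg, ← div_eq_mul_inv, div_le_div_iff₀ (Real.exp_pos _) hδ]
  have := Real.add_one_le_exp (δ * x)
  linarith

/-- value of the reparametrized profile -/
noncomputable def auxL (z a r b : ℝ) : ℝ := Real.log (Real.exp (a - r * z) + Real.exp b)

lemma auxL_ge_b (z a r b : ℝ) : b ≤ auxL z a r b := by
  unfold auxL
  rw [Real.le_log_iff_exp_le (by positivity)]
  have := Real.exp_pos (a - r * z)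
  linarith

lemma auxL_ge_a (z a r b : ℝ) : a - r * z ≤ auxL z a r b := by
  unfold auxL
  rw [Real.le_log_iff_exp_le (by positivity)]
  have := Real.exp_pos b
  linarith

lemma aux_E_bound (M z p a r b : ℝ) (hp : 0 < p) (hpM : p ≤ M)
    (hb : -M ≤ b) : Real.exp (-(p * auxL z a r b)) ≤ Real.exp (M * M) := by
  have h1 := auxL_ge_b z a r b
  apply Real.exp_le_exp.2
  have : p * (-M) ≤ p * auxL z a r b := mul_le_mul_of_nonneg_left (by linarith) hp.le
  nlinarith

lemma aux_LE_bound (M m z p a r b : ℝ) (hm : 0 < m) (hp : m ≤ p) (hpM : p ≤ M)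
    (hb : -M ≤ b) :
    |auxL z a r b| * Real.exp (-(p * auxL z a r b)) ≤ 1 / m + M * Real.exp (M * M) := by
  have h1 := auxL_ge_b z a r b
  have hE := aux_E_bound M z p a r b (by linarith) hpM hb
  have hM : 0 < M := by linarith
  rcases le_total 0 (auxL z a r b) with h | h
  · rw [abs_of_nonneg h]
    have h2 := aux_x_exp p (auxL z a r b) (by linarith)
    have h3 : 1 / p ≤ 1 / m := one_div_le_one_div_of_le hm hp
    have : 0 < M * Real.exp (M * M) := by positivity
    linarith
  · rw [abs_of_nonpos h]
    have h3 : 0 < 1 / m := by positivity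
    have : -auxL z a r b * Real.exp (-(p * auxL z a r b)) ≤ M * Real.exp (M * M) :=
      mul_le_mul (by linarith) hE (Real.exp_pos _).le hM.le
    linarith

/-- the softmax weight -/
noncomputable def auxS (z a r b : ℝ) : ℝ :=
  Real.exp (a - r * z) / (Real.exp (a - r * z) + Real.exp b)

lemma auxS_nonneg (z a r b : ℝ) : 0 ≤ auxS z a r b := by unfold auxS; positivity

lemma auxS_le_one (z a r b : ℝ) : auxS z a r b ≤ 1 := by
  unfold auxS
  rw [div_le_one (by positivity)]
  have := Real.exp_pos b
  linarith

lemma auxS_le (z a r b : ℝ) : auxS z a r b ≤ Real.exp (a - r * z - b) := by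
  unfold auxS
  rw [Real.exp_sub _ b]
  apply div_le_div_of_nonneg_left (Real.exp_pos _).le (Real.exp_pos _)
  have := Real.exp_pos (a - r * z)
  linarith

lemma aux_zSE_bound (M m z p a r b : ℝ) (hm : 0 < m) (hp : m ≤ p) (hpM : p ≤ M)
    (hr : m ≤ r) (ha : |a| ≤ M) (hb : |b| ≤ M) :
    |z| * auxS z a r b * Real.exp (-(p * auxL z a r b)) ≤
      Real.exp (2 * M) * (1 / m) * Real.exp (M * M) + 1 / (m * m) * Real.exp (M * M) := by
  rw [abs_le] at ha hb
  have hE := aux_E_bound M z p a r b (by linarith) hpM hb.1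
  have hM : 0 < M := by linarith
  have hS0 := auxS_nonneg z a r b
  rcases le_total 0 z with h | h
  · rw [abs_of_nonneg h]
    have h1 : auxS z a r b ≤ Real.exp (2 * M) * Real.exp (-(m * z)) := by
      refine (auxS_le z a r b).trans ?_
      rw [← Real.exp_add]
      apply Real.exp_le_exp.2
      nlinarith
    have h2 := aux_x_exp m z hm
    have h3 : z * auxS z a r b ≤ Real.exp (2 * M) * (1 / m) := by
      calc z * auxS z a r b ≤ z * (Real.exp (2 * M) * Real.exp (-(m * z))) := by gcongr
        _ = Real.exp (2 * M) * (z * Real.exp (-(m * z))) := by ring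
        _ ≤ _ := by gcongr
    have h4 : 0 < 1 / (m * m) * Real.exp (M * M) := by positivity
    have := mul_le_mul h3 hE (Real.exp_pos _).le (by positivity)
    linarith
  · rw [abs_of_nonpos h]
    have h1 := auxS_le_one z a r b
    have h2 := auxL_ge_a z a r b
    have h3 : Real.exp (-(p * auxL z a r b)) ≤ Real.exp (M * M) * Real.exp (-(m * m * (-z))) := by
      rw [← Real.exp_add]
      apply Real.exp_le_exp.2
      have e1 : m * (-z) ≤ r * (-z) := by nlinarith
      have e2 : p * (-M + m * (-z)) ≤ p * auxL z a r b :=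
        mul_le_mul_of_nonneg_left (by linarith) (by linarith)
      have e3 : m * (m * (-z)) ≤ p * (m * (-z)) :=
        mul_le_mul_of_nonneg_right hp (mul_nonneg hm.le (by linarith))
      nlinarith
    have h4 := aux_x_exp (m * m) (-z) (by positivity)
    have h5 : -z * auxS z a r b ≤ -z := by nlinarith
    have h6 : 0 < Real.exp (2 * M) * (1 / m) * Real.exp (M * M) := by positivity
    have : -z * auxS z a r b * Real.exp (-(p * auxL z a r b)) ≤
        1 / (m * m) * Real.exp (M * M) := by
      calc _ ≤ -z * (Real.exp (M * M) * Real.exp (-(m * m * (-z)))) :=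
            mul_le_mul h5 h3 (Real.exp_pos _).le (by linarith)
        _ = (-z * Real.exp (-(m * m * (-z)))) * Real.exp (M * M) := by ring
        _ ≤ _ := by gcongr
    linarith

lemma aux_hasDeriv (z p a r b p' a' r' b' t : ℝ) :
    HasDerivAt (fun t => Real.exp (-((p + t * p') *
        auxL z (a + t * a') (r + t * r') (b + t * b'))))
      (Real.exp (-((p + t * p') * auxL z (a + t * a') (r + t * r') (b + t * b'))) *
        (-(p' * auxL z (a + t * a') (r + t * r') (b + t * b') + (p + t * p') *
          (auxS z (a + t * a') (r + t * r') (b + t * b') * (a' - r' * z) +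
            (1 - auxS z (a + t * a') (r + t * r') (b + t * b')) * b')))) t := by
  have hl : ∀ c c' : ℝ, HasDerivAt (fun t : ℝ => c + t * c') c' t := fun c c' => by
    simpa using ((hasDerivAt_id t).mul_const c').const_add c
  have h1 := ((((hl a a').sub ((hl r r').mul_const z)).exp).add ((hl b b').exp)).log
    (by simp only [Pi.add_apply]; positivity)
  have h2 := ((hl p p').mul h1).neg.exp
  refine h2.congr_deriv ?_
  simp only [auxL, auxS, Pi.add_apply, Pi.mul_apply, Pi.neg_apply, Pi.sub_apply]
  have : Real.exp (a + t * a' - (r + t * r') * z) + Real.exp (b + t * b') ≠ 0 := by positivity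
  field_simp
  ring

lemma aux_lip (M m : ℝ) (hm : 0 < m) : ∃ K > 0, ∀ z p a r b q α ρ β D : ℝ,
    m ≤ p → p ≤ M → m ≤ r → |a| ≤ M → |b| ≤ M →
    m ≤ q → q ≤ M → m ≤ ρ → |α| ≤ M → |β| ≤ M →
    |p - q| ≤ D → |a - α| ≤ D → |r - ρ| ≤ D → |b - β| ≤ D →
    |Real.exp (-(p * auxL z a r b)) - Real.exp (-(q * auxL z α ρ β))| ≤ K * D := by
  by_cases hM : 0 < M
  swap
  · refine ⟨1, one_pos, ?_⟩
    intros; linarith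
  refine ⟨(1 / m + M * Real.exp (M * M)) + M * (Real.exp (M * M) +
    (Real.exp (2 * M) * (1 / m) * Real.exp (M * M) + 1 / (m * m) * Real.exp (M * M)) +
    Real.exp (M * M)), by positivity, ?_⟩
  intro z p a r b q α ρ β D hp hpM hr ha hb hq hqM hρ hα hβ dp da dr db
  have key := norm_image_sub_le_of_norm_deriv_le_segment_01'
    (f := fun t => Real.exp (-((q + t * (p - q)) *
        auxL z (α + t * (a - α)) (ρ + t * (r - ρ)) (β + t * (b - β)))))
    (fun t _ => (aux_hasDeriv z q α ρ β (p - q) (a - α) (r - ρ) (b - β) t).hasDerivWithinAt)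
    (C := ((1 / m + M * Real.exp (M * M)) + M * (Real.exp (M * M) +
    (Real.exp (2 * M) * (1 / m) * Real.exp (M * M) + 1 / (m * m) * Real.exp (M * M)) +
    Real.exp (M * M))) * D) ?_
  · simpa using key
  · intro t ht
    obtain ⟨ht0, ht1⟩ := ht
    rw [abs_le] at ha hb hα hβ
    have P1 : m ≤ q + t * (p - q) := by nlinarith
    have P2 : q + t * (p - q) ≤ M := by nlinarith
    have R1 : m ≤ ρ + t * (r - ρ) := by nlinarith
    have A1 : |α + t * (a - α)| ≤ M := by rw [abs_le]; constructor <;> nlinarith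
    have B1 : |β + t * (b - β)| ≤ M := by rw [abs_le]; constructor <;> nlinarith
    generalize q + t * (p - q) = p1 at *
    generalize ρ + t * (r - ρ) = r1 at *
    generalize α + t * (a - α) = a1 at *
    generalize β + t * (b - β) = b1 at *
    have e1 := aux_E_bound M z p1 a1 r1 b1 (by linarith) P2 (abs_le.1 B1).1
    have e2 := aux_LE_bound M m z p1 a1 r1 b1 hm P1 P2 (abs_le.1 B1).1
    have e3 := aux_zSE_bound M m z p1 a1 r1 b1 hm P1 P2 R1 A1 B1
    have s0 := auxS_nonneg z a1 r1 b1
    have s1 := auxS_le_one z a1 r1 b1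
    have e0 := Real.exp_pos (-(p1 * auxL z a1 r1 b1))
    generalize Real.exp (-(p1 * auxL z a1 r1 b1)) = E at *
    generalize auxL z a1 r1 b1 = L at *
    generalize auxS z a1 r1 b1 = S at *
    generalize p - q = p' at *
    generalize r - ρ = r' at *
    generalize a - α = a' at *
    generalize b - β = b' at *
    have hD : 0 ≤ D := (abs_nonneg _).trans dp
    have hp1 : 0 < p1 := by linarith
    have hs1 : 0 ≤ 1 - S := by linarith
    generalize (1 / m + M * Real.exp (M * M)) = c2 at *
    generalize (Real.exp (2 * M) * (1 / m) * Real.exp (M * M) + 1 / (m * m) * Real.exp (M * M))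
      = c3 at *
    generalize Real.exp (M * M) = c1 at *
    have f1 : |L * E * p'| ≤ c2 * D := by
      rw [abs_mul, abs_mul, abs_of_pos e0]
      exact mul_le_mul e2 dp (abs_nonneg _) ((by positivity : 0 ≤ |L| * E).trans e2)
    have f2 : |S * E * a'| ≤ c1 * D := by
      rw [abs_mul, abs_mul, abs_of_pos e0, abs_of_nonneg s0]
      exact mul_le_mul (by nlinarith) da (abs_nonneg _) (by linarith)
    have f3 : |z * S * E * r'| ≤ c3 * D := by
      rw [abs_mul, abs_mul, abs_mul, abs_of_pos e0, abs_of_nonneg s0]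
      exact mul_le_mul e3 dr (abs_nonneg _) ((by positivity : 0 ≤ |z| * S * E).trans e3)
    have f4 : |(1 - S) * E * b'| ≤ c1 * D := by
      rw [abs_mul, abs_mul, abs_of_pos e0, abs_of_nonneg hs1]
      exact mul_le_mul (by nlinarith) db (abs_nonneg _) (by linarith)
    have f5 : |S * E * a' - z * S * E * r' + (1 - S) * E * b'| ≤ c1 * D + c3 * D + c1 * D := by
      rw [abs_le] at f2 f3 f4 ⊢
      constructor <;> linarith
    have f6 : |p1 * (S * E * a' - z * S * E * r' + (1 - S) * E * b')| ≤
        M * (c1 * D + c3 * D + c1 * D) := by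
      rw [abs_mul, abs_of_pos hp1]
      exact mul_le_mul P2 f5 (abs_nonneg _) hM.le
    rw [Real.norm_eq_abs, show E * (-(p' * L + p1 * (S * (a' - r' * z) + (1 - S) * b'))) =
      -(L * E * p') - p1 * (S * E * a' - z * S * E * r' + (1 - S) * E * b') by ring]
    rw [abs_le] at f1 f6 ⊢
    constructor <;> linarith

/-- the reparametrization -/
noncomputable def auxF (W : EuclideanSpace ℝ (Fin 7)) : ℝ × ℝ × ℝ × ℝ :=
  (1 / (W 0 - 1),
   Real.log ((W 1 * W 2 * W 5 * (W 0 - 1)) / (2 * (W 3) ^ 2 * W 4)),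
   2 * W 4 * W 3 / W 5,
   -(W 0 - 1) * Real.log (W 6))

lemma auxF_contDiffAt (W : EuclideanSpace ℝ (Fin 7))
    (h : 1 < W 0 ∧ 0 < W 1 ∧ 0 < W 2 ∧ 0 < W 3 ∧ 0 < W 4 ∧ 0 < W 5 ∧ 0 < W 6) :
    ContDiffAt ℝ 1 auxF W := by
  obtain ⟨h0, h1, h2, h3, h4, h5, h6⟩ := h
  have hc : ∀ i : Fin 7, ContDiffAt ℝ 1 (fun W : EuclideanSpace ℝ (Fin 7) => W i) W := fun i => by
    fun_prop
  have g0 : 0 < W 0 - 1 := by linarith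
  have hd : ContDiffAt ℝ 1 (fun W : EuclideanSpace ℝ (Fin 7) => W 0 - 1) W :=
    (hc 0).sub contDiffAt_const
  unfold auxF
  refine ContDiffAt.prodMk ?_ (ContDiffAt.prodMk ?_ (ContDiffAt.prodMk ?_ ?_))
  · exact contDiffAt_const.div hd g0.ne'
  · refine ContDiffAt.log (ContDiffAt.div ?_ ?_ (by positivity)) (by positivity)
    · exact (((hc 1).mul (hc 2)).mul (hc 5)).mul hd
    · exact (contDiffAt_const.mul ((hc 3).pow 2)).mul (hc 4)
  · exact ((contDiffAt_const.mul (hc 4)).mul (hc 3)).div (hc 5) h5.ne'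
  · exact hd.neg.mul ((hc 6).log h6.ne')

lemma aux_rewrite (ζ : ℝ) (W : EuclideanSpace ℝ (Fin 7))
    (h : 1 < W 0 ∧ 0 < W 1 ∧ 0 < W 2 ∧ 0 < W 3 ∧ 0 < W 4 ∧ 0 < W 5 ∧ 0 < W 6) :
    ((W 1 * W 2 * W 5 * (W 0 - 1)) / (2 * (W 3) ^ 2 * W 4)
          * Real.exp (-(2 * W 4 * W 3 * ζ) / W 5)
        + (W 6) ^ (-(W 0 - 1))) ^ (-(1 / (W 0 - 1))) =
    Real.exp (-((auxF W).1 * auxL ζ (auxF W).2.1 (auxF W).2.2.1 (auxF W).2.2.2)) := by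
  obtain ⟨h0, h1, h2, h3, h4, h5, h6⟩ := h
  have g0 : 0 < W 0 - 1 := by linarith
  have hA : 0 < (W 1 * W 2 * W 5 * (W 0 - 1)) / (2 * (W 3) ^ 2 * W 4) := by positivity
  have hB : 0 < (W 6) ^ (-(W 0 - 1)) := Real.rpow_pos_of_pos h6 _
  simp only [auxF, auxL]
  rw [Real.rpow_def_of_pos (by positivity), Real.exp_sub, Real.exp_log hA,
    Real.rpow_def_of_pos h6]
  congr 1
  rw [show -(2 * W 4 * W 3 * ζ) / W 5 = -(2 * W 4 * W 3 / W 5 * ζ) by ring, Real.exp_neg,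
    ← div_eq_mul_inv, mul_comm (Real.log (W 6))]
  ring

/-- The substrate profile V(ζ, W), W = (d, C0, k, c, τ, μ, V∞) ∈ 𝔻 = (1,∞)×(0,∞)⁶,
is Lipschitz in the parameter vector W uniformly in ζ on any compact subset of 𝔻. -/
theorem unlimited_substrate_V_lipschitz_in_parameters
    (Vf : ℝ → EuclideanSpace ℝ (Fin 7) → ℝ)
    (hVf : ∀ (ζ : ℝ) (W : EuclideanSpace ℝ (Fin 7)), Vf ζ W =
      ((W 1 * W 2 * W 5 * (W 0 - 1)) / (2 * (W 3) ^ 2 * W 4)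
          * Real.exp (-(2 * W 4 * W 3 * ζ) / W 5)
        + (W 6) ^ (-(W 0 - 1))) ^ (-(1 / (W 0 - 1))))
    (Ω : Set (EuclideanSpace ℝ (Fin 7)))
    (hΩ : IsCompact Ω)
    (hΩD : Ω ⊆ {W : EuclideanSpace ℝ (Fin 7) |
      1 < W 0 ∧ 0 < W 1 ∧ 0 < W 2 ∧ 0 < W 3 ∧ 0 < W 4 ∧ 0 < W 5 ∧ 0 < W 6}) :
    ∃ K > 0, ∀ W1 ∈ Ω, ∀ W2 ∈ Ω, ∀ ζ : ℝ,
      |Vf ζ W1 - Vf ζ W2| ≤ K * ‖W1 - W2‖ := by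
  have hcont : ContinuousOn auxF Ω := fun W hW =>
    (auxF_contDiffAt W (hΩD hW)).continuousAt.continuousWithinAt
  have hloc : LocallyLipschitzOn Ω auxF := fun W hW => by
    obtain ⟨K, t, ht, hK⟩ := (auxF_contDiffAt W (hΩD hW)).exists_lipschitzOnWith
    exact ⟨K, t, mem_nhdsWithin_of_mem_nhds ht, hK⟩
  obtain ⟨K0, hK0⟩ := hloc.exists_lipschitzOnWith_of_compact hΩ
  obtain ⟨M, hM⟩ := hΩ.exists_bound_of_continuousOn hcont
  have hpos : ∀ W ∈ Ω, 0 < (auxF W).1 ∧ 0 < (auxF W).2.2.1 := fun W hW => by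
    obtain ⟨h0, h1, h2, h3, h4, h5, h6⟩ := hΩD hW
    have g0 : 0 < W 0 - 1 := by linarith
    simp only [auxF]
    constructor <;> positivity
  obtain ⟨N1, hN1⟩ := hΩ.exists_bound_of_continuousOn
    (f := fun W => ((auxF W).1)⁻¹) (hcont.fst.inv₀ fun W hW => (hpos W hW).1.ne')
  obtain ⟨N2, hN2⟩ := hΩ.exists_bound_of_continuousOn
    (f := fun W => ((auxF W).2.2.1)⁻¹) (hcont.snd.snd.fst.inv₀ fun W hW => (hpos W hW).2.ne')
  set N := max 1 (max N1 N2) with hN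
  have hN0 : 0 < N := lt_of_lt_of_le one_pos (le_max_left _ _)
  have hlow : ∀ W ∈ Ω, N⁻¹ ≤ (auxF W).1 ∧ N⁻¹ ≤ (auxF W).2.2.1 := fun W hW => by
    obtain ⟨a, b⟩ := hpos W hW
    constructor
    · refine inv_le_of_inv_le₀ a ?_
      exact (le_abs_self _).trans ((hN1 W hW).trans ((le_max_left _ _).trans (le_max_right _ _)))
    · refine inv_le_of_inv_le₀ b ?_
      exact (le_abs_self _).trans ((hN2 W hW).trans ((le_max_right _ _).trans (le_max_right _ _)))
  obtain ⟨K1, hK1, hlip⟩ := aux_lip M N⁻¹ (inv_pos.2 hN0)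
  refine ⟨K1 * (K0 + 1), by positivity, fun W1 hW1 W2 hW2 ζ => ?_⟩
  rw [hVf, hVf, aux_rewrite ζ W1 (hΩD hW1), aux_rewrite ζ W2 (hΩD hW2)]
  have hD : ‖auxF W1 - auxF W2‖ ≤ (K0 + 1) * ‖W1 - W2‖ := by
    have := hK0.norm_sub_le hW1 hW2
    nlinarith [norm_nonneg (W1 - W2)]
  have b1 := hM W1 hW1
  have b2 := hM W2 hW2
  simp only [Prod.norm_def, sup_le_iff, Prod.fst_sub, Prod.snd_sub, Real.norm_eq_abs] at b1 b2 hD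
  rw [mul_assoc]
  exact hlip _ _ _ _ _ _ _ _ _ _ (hlow W1 hW1).1 ((le_abs_self _).trans b1.1) (hlow W1 hW1).2
    b1.2.1 b1.2.2.2 (hlow W2 hW2).1 ((le_abs_self _).trans b2.1) (hlow W2 hW2).2
    b2.2.1 b2.2.2.2 hD.1 hD.2.1 hD.2.2.1 hD.2.2.2
end

section
/- The bacterial profile U is Lipschitz in the parameters uniformly in ζ: for any compact set Ω ⊂ 𝔻 there exists K > 0 such that for all parameter vectors W₁, W₂ ∈ Ω and all ζ ∈ ℝ, |U(ζ, W₁) − U(ζ, W₂)| ≤ K·|W₁ − W₂|. -/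
open Real Filter

lemma usl_comp (Ω : Set (EuclideanSpace ℝ (Fin 7))) (hΩ : IsCompact Ω)
    (f : EuclideanSpace ℝ (Fin 7) → ℝ) (hf : ∀ W ∈ Ω, ContDiffAt ℝ 1 f W) :
    ∃ K : ℝ, 1 ≤ K ∧ ∀ K', K ≤ K' → (∀ W ∈ Ω, |f W| ≤ K') ∧
      ∀ W1 ∈ Ω, ∀ W2 ∈ Ω, |f W1 - f W2| ≤ K' * ‖W1 - W2‖ := by
  have hl : LocallyLipschitzOn Ω f := by
    intro W hW
    obtain ⟨K, t, ht, h⟩ := (hf W hW).exists_lipschitzOnWith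
    exact ⟨K, t, mem_nhdsWithin_of_mem_nhds ht, h⟩
  obtain ⟨K, hK⟩ := hl.exists_lipschitzOnWith_of_compact hΩ
  obtain ⟨C, hC⟩ := hΩ.exists_bound_of_continuousOn hl.continuousOn
  refine ⟨max 1 (max K C), le_max_left _ _, fun K' hK' => ⟨fun W hW => ?_, fun W1 h1 W2 h2 => ?_⟩⟩
  · exact (hC W hW).trans (((le_max_right _ _).trans (le_max_right _ _)).trans hK')
  · have := hK.dist_le_mul W1 h1 W2 h2
    rw [dist_eq_norm, dist_eq_norm, Real.norm_eq_abs] at this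
    refine this.trans ?_
    gcongr
    exact ((le_max_left _ _).trans (le_max_right _ _)).trans hK'

noncomputable def uslL (x y : ℝ) : ℝ := Real.log (Real.exp x + Real.exp y)

lemma uslL_le {x y x' y' D : ℝ} (hx : x ≤ x' + D) (hy : y ≤ y' + D) :
    uslL x y ≤ uslL x' y' + D := by
  unfold uslL
  have h : Real.log (Real.exp x' + Real.exp y') + D
      = Real.log ((Real.exp x' + Real.exp y') * Real.exp D) := by
    rw [Real.log_mul (by positivity) (by positivity), Real.log_exp]
  rw [h]
  apply Real.log_le_log (by positivity)
  rw [add_mul, ← Real.exp_add, ← Real.exp_add]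
  gcongr

lemma uslL_ge_left (x y : ℝ) : x ≤ uslL x y := by
  unfold uslL
  rw [Real.le_log_iff_exp_le (by positivity)]
  linarith [Real.exp_pos y]

lemma uslL_ge_right (x y : ℝ) : y ≤ uslL x y := by
  unfold uslL
  rw [Real.le_log_iff_exp_le (by positivity)]
  linarith [Real.exp_pos x]

lemma uslL_abs {x y D : ℝ} (hx : |x| ≤ D) (hy : |y| ≤ D) : |uslL x y| ≤ 1 + D := by
  rw [abs_le] at *
  constructor
  · linarith [uslL_ge_left x y]
  · have h := @uslL_le x y 0 0 D (by linarith) (by linarith)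
    have : uslL 0 0 ≤ 1 := by
      unfold uslL
      have := Real.log_le_sub_one_of_pos (x := Real.exp 0 + Real.exp 0) (by positivity)
      simp at this ⊢
      linarith
    linarith

lemma uslL_sub {x y x' y' D : ℝ} (hx : |x - x'| ≤ D) (hy : |y - y'| ≤ D) :
    |uslL x y - uslL x' y'| ≤ D := by
  rw [abs_le] at *
  have h1 := @uslL_le x y x' y' D (by linarith) (by linarith)
  have h2 := @uslL_le x' y' x y D (by linarith) (by linarith)
  constructor <;> linarith

noncomputable def uslG (z l a p α β : ℝ) : ℝ := l - a * z - p * uslL (α - a * z) β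

lemma uslG_decay {z l a p α β K : ℝ} (hK : 1 ≤ K) (hl : |l| ≤ K) (hp : |p| ≤ K)
    (hα : |α| ≤ K) (hβ : |β| ≤ K) (ha' : 1 ≤ a * K) (hp' : 1 ≤ (p - 1) * K) :
    Real.exp (uslG z l a p α β) * (1 + |z|) ≤ Real.exp (K + K ^ 2) * K ^ 2 := by
  have hK0 : 0 < K := by linarith
  have ha0 : 1 / K ≤ a := by rwa [div_le_iff₀ hK0]
  have hp0 : 1 / K ≤ p - 1 := by rwa [div_le_iff₀ hK0]
  have hi : 0 < 1 / K := by positivity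
  have hi1 : 1 / K ≤ 1 := by rw [div_le_iff₀ hK0]; linarith
  have hpp : 0 ≤ p := by linarith
  have hsq : 1 / K ^ 2 = 1 / K * (1 / K) := by field_simp
  have hpb : |p * β| ≤ K ^ 2 := by rw [abs_mul, pow_two]; gcongr
  have hpa : |p * α| ≤ K ^ 2 := by rw [abs_mul, pow_two]; gcongr
  rw [abs_le] at hpb hpa hl
  have hg : uslG z l a p α β ≤ (K + K ^ 2) - |z| / K ^ 2 := by
    unfold uslG
    have h1 := mul_le_mul_of_nonneg_left (uslL_ge_left (α - a * z) β) hpp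
    have h2 := mul_le_mul_of_nonneg_left (uslL_ge_right (α - a * z) β) hpp
    have e : |z| / K ^ 2 = 1 / K ^ 2 * |z| := by ring
    rw [e, hsq]
    rcases le_total 0 z with hz | hz
    · rw [abs_of_nonneg hz]
      have : 1 / K * (1 / K) * z ≤ a * z := by
        apply mul_le_mul_of_nonneg_right _ hz
        nlinarith
      linarith
    · rw [abs_of_nonpos hz]
      have : 1 / K * (1 / K) * (-z) ≤ ((p - 1) * a) * (-z) := by
        apply mul_le_mul_of_nonneg_right _ (by linarith)
        gcongr
        linarith
      nlinarith
  have h3 : 1 + |z| ≤ K ^ 2 * Real.exp (|z| / K ^ 2) := by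
    have h4 := Real.add_one_le_exp (|z| / K ^ 2)
    have h5 : K ^ 2 * (|z| / K ^ 2 + 1) ≤ K ^ 2 * Real.exp (|z| / K ^ 2) := by gcongr
    have h6 : K ^ 2 * (|z| / K ^ 2 + 1) = |z| + K ^ 2 := by field_simp
    nlinarith
  calc _ ≤ Real.exp ((K + K ^ 2) - |z| / K ^ 2) * (K ^ 2 * Real.exp (|z| / K ^ 2)) := by
        gcongr
    _ = _ := by
        rw [Real.exp_sub]; field_simp

lemma usl_exp (x y : ℝ) : |Real.exp x - Real.exp y| ≤ (Real.exp x + Real.exp y) * |x - y| := by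
  have h1 := Real.add_one_le_exp (y - x)
  have h2 := Real.add_one_le_exp (x - y)
  have e1 : Real.exp y = Real.exp x * Real.exp (y - x) := by rw [← Real.exp_add]; ring_nf
  have e2 : Real.exp x = Real.exp y * Real.exp (x - y) := by rw [← Real.exp_add]; ring_nf
  have p1 := Real.exp_pos x
  have p2 := Real.exp_pos y
  have i1 : Real.exp x - Real.exp y ≤ Real.exp x * (x - y) := by nlinarith
  have i2 : Real.exp y - Real.exp x ≤ Real.exp y * (y - x) := by nlinarith
  have j1 : Real.exp x * (x - y) ≤ Real.exp x * |x - y| := by gcongr; exact le_abs_self _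
  have j2 : Real.exp y * (y - x) ≤ Real.exp y * |x - y| := by
    gcongr; rw [abs_sub_comm]; exact le_abs_self _
  have k1 : 0 ≤ Real.exp x * |x - y| := by positivity
  have k2 : 0 ≤ Real.exp y * |x - y| := by positivity
  rw [abs_le]
  constructor <;> nlinarith

lemma uslG_sub {z l a p α β l' a' p' α' β' K D : ℝ} (hK : 1 ≤ K) (hD : 0 ≤ D)
    (ha : |a| ≤ K) (hp : |p'| ≤ K) (hα : |α| ≤ K) (hβ : |β| ≤ K)
    (dl : |l - l'| ≤ K * D) (da : |a - a'| ≤ K * D) (dp : |p - p'| ≤ K * D)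
    (dα : |α - α'| ≤ K * D) (dβ : |β - β'| ≤ K * D) :
    |uslG z l a p α β - uslG z l' a' p' α' β'| ≤ (2 * K + 2 * K ^ 2) * D * (1 + |z|) := by
  have hz := abs_nonneg z
  have hKD : 0 ≤ K * D := by positivity
  have daz : |a * z - a' * z| ≤ K * D * |z| := by
    rw [← sub_mul, abs_mul]; gcongr
  have haz : |a * z| ≤ K * |z| := by rw [abs_mul]; gcongr
  have hL : |uslL (α - a * z) β| ≤ 1 + K * (1 + |z|) := by
    apply uslL_abs
    · have := abs_sub α (a * z); linarith
    · nlinarith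
  have hLL : |uslL (α - a * z) β - uslL (α' - a' * z) β'| ≤ K * D * (1 + |z|) := by
    apply uslL_sub
    · have e : α - a * z - (α' - a' * z) = (α - α') - (a * z - a' * z) := by ring
      rw [e]
      have := abs_sub (α - α') (a * z - a' * z); linarith
    · nlinarith
  unfold uslG
  set L := uslL (α - a * z) β
  set L' := uslL (α' - a' * z) β'
  have e : l - a * z - p * L - (l' - a' * z - p' * L')
      = (l - l') - (a * z - a' * z) - ((p - p') * L + p' * (L - L')) := by ring
  have m1 : |(p - p') * L| ≤ (K * D) * (1 + K * (1 + |z|)) := by rw [abs_mul]; gcongr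
  have m2 : |p' * (L - L')| ≤ K * (K * D * (1 + |z|)) := by rw [abs_mul]; gcongr
  have t1 := abs_sub ((l - l') - (a * z - a' * z)) ((p - p') * L + p' * (L - L'))
  have t2 := abs_sub (l - l') (a * z - a' * z)
  have t3 := abs_add_le ((p - p') * L) (p' * (L - L'))
  rw [e]
  have : 0 ≤ K * D * |z| := by positivity
  nlinarith

lemma usl_U (z d C k c τ μ v : ℝ) (hd : 1 < d) (hC : 0 < C) (hk : 0 < k) (hc : 0 < c)
    (hτ : 0 < τ) (hμ : 0 < μ) (hv : 0 < v) :
    C * (((C * k * μ * (d - 1)) / (2 * c ^ 2 * τ) * Real.exp (-(2 * τ * c * z) / μ)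
        + v ^ (-(d - 1))) ^ (-(1 / (d - 1)))) ^ d * Real.exp (-(2 * τ * c * z) / μ)
    = Real.exp (uslG z (Real.log C) (2 * τ * c / μ) (d / (d - 1))
        (Real.log ((C * k * μ * (d - 1)) / (2 * c ^ 2 * τ))) (-(d - 1) * Real.log v)) := by
  have hd' : 0 < d - 1 := by linarith
  have hA : 0 < (C * k * μ * (d - 1)) / (2 * c ^ 2 * τ) := by positivity
  have hz : -(2 * τ * c * z) / μ = - (2 * τ * c / μ * z) := by ring
  have hS : (C * k * μ * (d - 1)) / (2 * c ^ 2 * τ) * Real.exp (-(2 * τ * c * z) / μ)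
        + v ^ (-(d - 1)) = Real.exp (uslL (Real.log ((C * k * μ * (d - 1)) / (2 * c ^ 2 * τ))
          - 2 * τ * c / μ * z) (-(d - 1) * Real.log v)) := by
    unfold uslL
    rw [Real.exp_log (by positivity), sub_eq_add_neg (Real.log _), Real.exp_add, Real.exp_log hA, hz,
      Real.rpow_def_of_pos hv, mul_comm (Real.log v)]
  rw [hS, hz]
  unfold uslG
  rw [← Real.exp_mul, ← Real.exp_mul]
  nth_rewrite 1 [← Real.exp_log hC]
  rw [← Real.exp_add, ← Real.exp_add]
  congr 1
  ring

/-- The bacterial profile U(ζ, W), W = (d, C0, k, c, τ, μ, V∞) ∈ 𝔻 = (1,∞)×(0,∞)⁶,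
is Lipschitz in the parameter vector W uniformly in ζ on any compact subset of 𝔻. -/
theorem unlimited_substrate_U_lipschitz_in_parameters
    (Vf Uf : ℝ → EuclideanSpace ℝ (Fin 7) → ℝ)
    (hVf : ∀ (ζ : ℝ) (W : EuclideanSpace ℝ (Fin 7)), Vf ζ W =
      ((W 1 * W 2 * W 5 * (W 0 - 1)) / (2 * (W 3) ^ 2 * W 4)
          * Real.exp (-(2 * W 4 * W 3 * ζ) / W 5)
        + (W 6) ^ (-(W 0 - 1))) ^ (-(1 / (W 0 - 1))))
    (hUf : ∀ (ζ : ℝ) (W : EuclideanSpace ℝ (Fin 7)), Uf ζ W =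
      W 1 * (Vf ζ W) ^ (W 0) * Real.exp (-(2 * W 4 * W 3 * ζ) / W 5))
    (Ω : Set (EuclideanSpace ℝ (Fin 7)))
    (hΩ : IsCompact Ω)
    (hΩD : Ω ⊆ {W : EuclideanSpace ℝ (Fin 7) |
      1 < W 0 ∧ 0 < W 1 ∧ 0 < W 2 ∧ 0 < W 3 ∧ 0 < W 4 ∧ 0 < W 5 ∧ 0 < W 6}) :
    ∃ K > 0, ∀ W1 ∈ Ω, ∀ W2 ∈ Ω, ∀ ζ : ℝ,
      |Uf ζ W1 - Uf ζ W2| ≤ K * ‖W1 - W2‖ := by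
  have hc : ∀ (i : Fin 7) (W : EuclideanSpace ℝ (Fin 7)),
      ContDiffAt ℝ 1 (fun W : EuclideanSpace ℝ (Fin 7) => W i) W := fun i W => by fun_prop
  obtain ⟨K1, hK1, H1⟩ := usl_comp Ω hΩ (fun W => Real.log (W 1)) (by
    intro W hW
    obtain ⟨h0, h1, h2, h3, h4, h5, h6⟩ := hΩD hW
    exact (hc 1 W).log h1.ne')
  obtain ⟨K2, hK2, H2⟩ := usl_comp Ω hΩ (fun W => 2 * W 4 * W 3 / W 5) (by
    intro W hW
    obtain ⟨h0, h1, h2, h3, h4, h5, h6⟩ := hΩD hW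
    exact ((contDiffAt_const.mul (hc 4 W)).mul (hc 3 W)).div (hc 5 W) h5.ne')
  obtain ⟨K3, hK3, H3⟩ := usl_comp Ω hΩ (fun W => W 0 / (W 0 - 1)) (by
    intro W hW
    obtain ⟨h0, h1, h2, h3, h4, h5, h6⟩ := hΩD hW
    exact (hc 0 W).div ((hc 0 W).sub contDiffAt_const) (sub_pos.2 h0).ne')
  obtain ⟨K4, hK4, H4⟩ := usl_comp Ω hΩ
    (fun W => Real.log ((W 1 * W 2 * W 5 * (W 0 - 1)) / (2 * (W 3) ^ 2 * W 4))) (by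
    intro W hW
    obtain ⟨h0, h1, h2, h3, h4, h5, h6⟩ := hΩD hW
    have hd := sub_pos.2 h0
    refine ContDiffAt.log (ContDiffAt.div ((((hc 1 W).mul (hc 2 W)).mul (hc 5 W)).mul
      ((hc 0 W).sub contDiffAt_const)) ((contDiffAt_const.mul ((hc 3 W).pow 2)).mul (hc 4 W))
      ?_) ?_ <;> positivity)
  obtain ⟨K5, hK5, H5⟩ := usl_comp Ω hΩ (fun W => -(W 0 - 1) * Real.log (W 6)) (by
    intro W hW
    obtain ⟨h0, h1, h2, h3, h4, h5, h6⟩ := hΩD hW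
    exact ((hc 0 W).sub contDiffAt_const).neg.mul ((hc 6 W).log h6.ne'))
  obtain ⟨K6, hK6, H6⟩ := usl_comp Ω hΩ (fun W => W 5 / (2 * W 4 * W 3)) (by
    intro W hW
    obtain ⟨h0, h1, h2, h3, h4, h5, h6⟩ := hΩD hW
    exact (hc 5 W).div ((contDiffAt_const.mul (hc 4 W)).mul (hc 3 W)) (by positivity))
  obtain ⟨K7, hK7, H7⟩ := usl_comp Ω hΩ (fun W => W 0 - 1) (by
    intro W hW
    exact (hc 0 W).sub contDiffAt_const)
  obtain ⟨K, hK⟩ : ∃ K, K = K1 + K2 + K3 + K4 + K5 + K6 + K7 := ⟨_, rfl⟩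
  have hK1' : 1 ≤ K := by linarith
  obtain ⟨B1, L1⟩ := H1 K (by linarith)
  obtain ⟨B2, L2⟩ := H2 K (by linarith)
  obtain ⟨B3, L3⟩ := H3 K (by linarith)
  obtain ⟨B4, L4⟩ := H4 K (by linarith)
  obtain ⟨B5, L5⟩ := H5 K (by linarith)
  obtain ⟨B6, -⟩ := H6 K (by linarith)
  obtain ⟨B7, -⟩ := H7 K (by linarith)
  have hU : ∀ W ∈ Ω, ∀ z, Uf z W = Real.exp (uslG z (Real.log (W 1)) (2 * W 4 * W 3 / W 5)
      (W 0 / (W 0 - 1)) (Real.log ((W 1 * W 2 * W 5 * (W 0 - 1)) / (2 * (W 3) ^ 2 * W 4)))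
      (-(W 0 - 1) * Real.log (W 6))) := by
    intro W hW z
    obtain ⟨h0, h1, h2, h3, h4, h5, h6⟩ := hΩD hW
    rw [hUf, hVf]
    exact usl_U z _ _ _ _ _ _ _ h0 h1 h2 h3 h4 h5 h6
  have hdec : ∀ W ∈ Ω, ∀ z, Uf z W * (1 + |z|) ≤ Real.exp (K + K ^ 2) * K ^ 2 := by
    intro W hW z
    rw [hU W hW]
    obtain ⟨h0, h1, h2, h3, h4, h5, h6⟩ := hΩD hW
    have hd := sub_pos.2 h0
    refine uslG_decay hK1' (B1 W hW) (B3 W hW) (B4 W hW) (B5 W hW) ?_ ?_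
    · have h := le_of_abs_le (B6 W hW)
      calc (1 : ℝ) = 2 * W 4 * W 3 / W 5 * (W 5 / (2 * W 4 * W 3)) := by field_simp
        _ ≤ _ := by gcongr
    · have h := le_of_abs_le (B7 W hW)
      have e : W 0 / (W 0 - 1) - 1 = 1 / (W 0 - 1) := by field_simp; ring
      rw [e]
      calc (1 : ℝ) = 1 / (W 0 - 1) * (W 0 - 1) := by field_simp
        _ ≤ _ := by gcongr
  refine ⟨2 * (Real.exp (K + K ^ 2) * K ^ 2) * (2 * K + 2 * K ^ 2), by positivity, ?_⟩
  intro W1 h1 W2 h2 z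
  have d1 := hdec W1 h1 z
  have d2 := hdec W2 h2 z
  have hs := uslG_sub (z := z) hK1' (norm_nonneg (W1 - W2)) (B2 W1 h1) (B3 W2 h2) (B4 W1 h1)
    (B5 W1 h1) (L1 W1 h1 W2 h2) (L2 W1 h1 W2 h2) (L3 W1 h1 W2 h2) (L4 W1 h1 W2 h2)
    (L5 W1 h1 W2 h2)
  rw [hU W1 h1] at d1 ⊢
  rw [hU W2 h2] at d2 ⊢
  refine (usl_exp _ _).trans ((mul_le_mul_of_nonneg_left hs (by positivity)).trans ?_)
  have hn : 0 ≤ (2 * K + 2 * K ^ 2) * ‖W1 - W2‖ := by positivity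
  have := mul_le_mul_of_nonneg_right (add_le_add d1 d2) hn
  refine le_trans (le_of_eq ?_) (this.trans (le_of_eq ?_)) <;> ring
end

section
/- The family of substrate profiles converges uniformly on ℝ as the chemotaxis-to-motility ratio tends to 1 from above: sup_{ζ ∈ ℝ} |V_d(ζ) − V₁(ζ)| → 0 as d → 1⁺. -/
open Real Filter

lemma aux_exp_sub (a b : ℝ) : exp (-a) - exp (-b) ≤ exp (-a) * (b - a) := by
  have h1 : exp (-b) = exp (-a) * exp (a - b) := by rw [← exp_add]; congr 1; ring
  have h2 := add_one_le_exp (a - b)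
  have h3 := exp_pos (-a)
  rw [h1]
  nlinarith

lemma aux_mul_exp (a : ℝ) : a * exp (-a) ≤ 1 := by
  have h1 := add_one_le_exp a
  have h3 := exp_pos (-a)
  have h4 : exp a * exp (-a) = 1 := by rw [← exp_add]; simp
  nlinarith

lemma aux_scale (A y : ℝ) (hA : 1 / 2 ≤ A) (hy : 0 ≤ y) :
    |exp (-(A * y)) - exp (-y)| ≤ 2 * |A - 1| := by
  have p1 := aux_mul_exp (A * y)
  have p2 := aux_mul_exp y
  have q1 := aux_exp_sub (A * y) y
  have q2 := aux_exp_sub y (A * y)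
  have e1 := exp_pos (-(A * y))
  have e2 := exp_pos (-y)
  have n1 : 0 ≤ y * exp (-(A * y)) := by positivity
  have n2 : 0 ≤ y * exp (-y) := by positivity
  have r1 : y * exp (-(A * y)) ≤ 2 := by nlinarith
  rcases le_total A 1 with h | h
  · rw [abs_of_nonpos (by linarith : A - 1 ≤ 0), abs_of_nonneg]
    · nlinarith
    · rw [sub_nonneg, exp_le_exp]; nlinarith
  · rw [abs_of_nonneg (by linarith : 0 ≤ A - 1), abs_of_nonpos]
    · nlinarith
    · rw [sub_nonpos, exp_le_exp]; nlinarith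

lemma aux_pow (s z : ℝ) (hs : 0 < s) (hs2 : s ≤ 1 / 2) (hz : 0 ≤ z) :
    |(1 + s * z) ^ (-(1 / s)) - exp (-z)| ≤ 2 * s := by
  have hx : 0 ≤ s * z := by positivity
  have hpos : 0 < 1 + s * z := by positivity
  set u := log (1 + s * z) / s with hu
  have hE : (1 + s * z) ^ (-(1 / s)) = exp (-u) := by
    rw [rpow_def_of_pos hpos, hu]; congr 1; ring
  have hus : u * s = log (1 + s * z) := by rw [hu]; field_simp
  have huz : u ≤ z := by
    have := log_le_sub_one_of_pos hpos
    nlinarith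
  have hlow : z - u ≤ s * z ^ 2 / 2 := by
    have h := le_log_one_add_of_nonneg hx
    have h2 : s * z - (s * z) ^ 2 / 2 ≤ 2 * (s * z) / (s * z + 2) := by
      rw [le_div_iff₀ (by positivity)]
      nlinarith [pow_nonneg hx 3]
    have h3 : s * (z - u) ≤ s * (s * z ^ 2 / 2) := by nlinarith
    exact le_of_mul_le_mul_left h3 hs
  have hb : z ^ 2 / 4 ≤ exp u := by
    have h := one_add_mul_self_le_rpow_one_add (by linarith : -1 ≤ s * z)
      (by rw [le_div_iff₀ (by positivity)]; linarith : 1 ≤ 1 / (2 * s))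
    have h1 : (1 + s * z) ^ (1 / (2 * s)) = exp (u / 2) := by
      rw [rpow_def_of_pos hpos, hu]; congr 1; field_simp
    have h2 : 1 / (2 * s) * (s * z) = z / 2 := by field_simp
    rw [h1, h2] at h
    have h3 : exp u = exp (u / 2) * exp (u / 2) := by rw [← exp_add]; congr 1; ring
    rw [h3]; nlinarith
  rw [hE, abs_of_nonneg (by rw [sub_nonneg, exp_le_exp]; linarith)]
  have q := aux_exp_sub u z
  have e := exp_pos (-u)
  have h4 : exp u * exp (-u) = 1 := by rw [← exp_add]; simp
  have h5 : z ^ 2 * exp (-u) ≤ 4 := by nlinarith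
  have h6 : exp (-u) * (z - u) ≤ exp (-u) * (s * z ^ 2 / 2) :=
    mul_le_mul_of_nonneg_left hlow e.le
  nlinarith

/-- The family of substrate profiles V_d converges uniformly on ℝ to V₁ as d → 1⁺. -/
theorem unlimited_substrate_V_uniform_convergence
    (C0 k c τ μ Vinf B : ℝ)
    (hC0 : 0 < C0) (hk : 0 < k) (hc : 0 < c) (hτ : 0 < τ) (hμ : 0 < μ)
    (hVinf : 0 < Vinf)
    (hB : B = C0 * k * μ / (2 * c ^ 2 * τ))
    (Vd : ℝ → ℝ → ℝ) (V1 : ℝ → ℝ)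
    (hVd : ∀ d : ℝ, 1 < d → ∀ ζ : ℝ, Vd d ζ =
      (B * (d - 1) * Real.exp (-(2 * τ * c * ζ) / μ)
        + Vinf ^ (-(d - 1))) ^ (-(1 / (d - 1))))
    (hV1 : ∀ ζ : ℝ, V1 ζ = Vinf * Real.exp (-B * Real.exp (-(2 * τ * c * ζ) / μ))) :
    TendstoUniformly Vd V1 (nhdsWithin 1 (Set.Ioi 1)) := by
  have hBp : 0 < B := by rw [hB]; positivity
  have hlim : Tendsto (fun d : ℝ => Vinf * (2 * (d - 1) + 2 * |Vinf ^ (d - 1) - 1|))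
      (nhdsWithin 1 (Set.Ioi 1)) (nhds 0) := by
    have hc : Continuous (fun d : ℝ => Vinf * (2 * (d - 1) + 2 * |Vinf ^ (d - 1) - 1|)) := by
      have : Continuous (fun d : ℝ => Vinf ^ (d - 1)) :=
        Continuous.rpow continuous_const (by fun_prop) (fun _ => Or.inl hVinf.ne')
      fun_prop
    have := hc.tendsto 1
    simp only [sub_self, rpow_zero, abs_zero, mul_zero, add_zero] at this
    exact this.mono_left nhdsWithin_le_nhds
  have hA : ∀ᶠ d : ℝ in nhdsWithin 1 (Set.Ioi 1), 1 / 2 ≤ Vinf ^ (d - 1) := by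
    have hc : Continuous (fun d : ℝ => Vinf ^ (d - 1)) :=
      Continuous.rpow continuous_const (by fun_prop) (fun _ => Or.inl hVinf.ne')
    have := hc.tendsto 1
    simp only [sub_self, rpow_zero] at this
    exact (this.mono_left nhdsWithin_le_nhds).eventually (eventually_ge_nhds (by norm_num))
  have hd2 : ∀ᶠ d : ℝ in nhdsWithin 1 (Set.Ioi 1), d ≤ 3 / 2 :=
    nhdsWithin_le_nhds (eventually_le_nhds (by norm_num))
  rw [Metric.tendstoUniformly_iff]
  intro ε hε
  filter_upwards [hA, hd2, self_mem_nhdsWithin, hlim.eventually (gt_mem_nhds hε)]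
    with d hA hd2 hd hlt ζ
  have hd : 1 < d := hd
  refine lt_of_le_of_lt ?_ hlt
  rw [dist_comm, Real.dist_eq, hVd d hd, hV1]
  set s := d - 1 with hs
  have hs0 : 0 < s := by linarith
  set E := Real.exp (-(2 * τ * c * ζ) / μ) with hE
  have hE0 : 0 < E := exp_pos _
  set A := Vinf ^ s with hAdef
  have hA0 : 0 < A := by linarith
  have hy : 0 ≤ B * E := by positivity
  have key : (B * s * E + Vinf ^ (-s)) ^ (-(1 / s))
      = Vinf * (1 + s * (A * (B * E))) ^ (-(1 / s)) := by
    have h1 : B * s * E + Vinf ^ (-s) = Vinf ^ (-s) * (1 + s * (A * (B * E))) := by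
      rw [rpow_neg hVinf.le, ← hAdef]; field_simp; ring
    rw [h1, mul_rpow (by positivity) (by positivity), ← rpow_mul hVinf.le]
    have : -s * -(1 / s) = 1 := by field_simp
    rw [this, rpow_one]
  have b1 := aux_pow s (A * (B * E)) hs0 (by linarith) (by positivity)
  have b2 := aux_scale A (B * E) hA hy
  rw [key, ← mul_sub, abs_mul, abs_of_pos hVinf, neg_mul]
  refine mul_le_mul_of_nonneg_left ?_ hVinf.le
  exact (abs_sub_le _ (Real.exp (-(A * (B * E)))) _).trans (add_le_add b1 b2)
end

section
/- The family of bacterial profiles converges uniformly on ℝ as the chemotaxis-to-motility ratio tends to 1 from above: sup_{ζ ∈ ℝ} |U_d(ζ) − U₁(ζ)| → 0 as d → 1⁺. -/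
open Real Filter

lemma aux_sq (z : ℝ) (hz : 0 ≤ z) : z ^ 2 * Real.exp (-z) ≤ 2 := by
  have h := Real.quadratic_le_exp_of_nonneg hz
  have h1 : Real.exp z * Real.exp (-z) = 1 := by rw [← Real.exp_add]; simp
  have hp := Real.exp_pos (-z)
  nlinarith [mul_nonneg hz hp.le]

lemma aux_one (z : ℝ) : z * Real.exp (-z) ≤ 1 := by
  have h := Real.add_one_le_exp z
  have h1 : Real.exp z * Real.exp (-z) = 1 := by rw [← Real.exp_add]; simp
  have hp := Real.exp_pos (-z)
  nlinarith

lemma aux_diff (a b : ℝ) : Real.exp (-a) - Real.exp (-b) ≤ (b - a) * Real.exp (-a) := by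
  have h := Real.add_one_le_exp (a - b)
  have h1 : Real.exp (-b) = Real.exp (a - b) * Real.exp (-a) := by
    rw [← Real.exp_add]; ring_nf
  have hp := Real.exp_pos (-a)
  rw [h1]; nlinarith

lemma aux_shift (z W : ℝ) (hz : 0 ≤ z) (hW : 1 / 2 ≤ W) :
    |z * W * Real.exp (-(z * W)) - z * Real.exp (-z)| ≤ 10 * |W - 1| := by
  have h1 : z * Real.exp (-(z * W)) ≤ 2 := by
    have := aux_one (z * W)
    have hp : 0 ≤ z * Real.exp (-(z * W)) := by positivity
    nlinarith
  have h1' : 0 ≤ z * Real.exp (-(z * W)) := by positivity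
  have hs := aux_sq (z / 2) (by linarith)
  have hs' : z ^ 2 * Real.exp (-(z / 2)) ≤ 8 := by nlinarith
  have hD : |Real.exp (-(z * W)) - Real.exp (-z)| ≤ z * |W - 1| * Real.exp (-(z / 2)) := by
    have e1 : Real.exp (-(z * W)) ≤ Real.exp (-(z / 2)) := Real.exp_le_exp.2 (by nlinarith)
    have e2 : Real.exp (-z) ≤ Real.exp (-(z / 2)) := Real.exp_le_exp.2 (by nlinarith)
    have p1 := Real.exp_pos (-(z * W))
    have p2 := Real.exp_pos (-z)
    have d1 := aux_diff (z * W) z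
    have d2 := aux_diff z (z * W)
    have k1 : (z - z * W) ≤ z * |W - 1| := by nlinarith [neg_abs_le (W - 1)]
    have k2 : (z * W - z) ≤ z * |W - 1| := by nlinarith [le_abs_self (W - 1)]
    have k0 : 0 ≤ z * |W - 1| := by positivity
    rw [abs_le]
    constructor
    · have := mul_le_mul k2 e2 p2.le k0
      linarith
    · have := mul_le_mul k1 e1 p1.le k0
      linarith
  have e : z * W * Real.exp (-(z * W)) - z * Real.exp (-z)
      = (W - 1) * (z * Real.exp (-(z * W))) + z * (Real.exp (-(z * W)) - Real.exp (-z)) := by ring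
  rw [e]
  refine (abs_add_le _ _).trans ?_
  rw [abs_mul (W - 1), abs_mul z (_ - _), abs_of_nonneg h1', abs_of_nonneg hz]
  have a1 := mul_le_mul_of_nonneg_left h1 (abs_nonneg (W - 1))
  have a2 := mul_le_mul_of_nonneg_left hD hz
  have a3 := mul_le_mul_of_nonneg_left hs' (abs_nonneg (W - 1))
  nlinarith

lemma aux_main (e y : ℝ) (he : 0 < e) (he3 : e ≤ 1 / 3) (hy : 0 ≤ y) :
    |y * Real.exp (-((1 + 1 / e) * Real.log (1 + e * y))) - y * Real.exp (-y)| ≤ 27 * e := by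
  have hey : 0 ≤ e * y := by positivity
  have hpos : 0 < 1 + e * y := by linarith
  set L := Real.log (1 + e * y) with hL
  have hL0 : 0 ≤ L := Real.log_nonneg (by linarith)
  have hL1 : L ≤ e * y := by have := Real.log_le_sub_one_of_pos hpos; linarith
  have hL2 : e * y - (e * y) ^ 2 ≤ L := by
    have := Real.one_sub_inv_le_log_of_pos hpos
    have h2 : e * y - (e * y) ^ 2 ≤ 1 - (1 + e * y)⁻¹ := by
      have : 1 - (1 + e * y)⁻¹ - (e * y - (e * y) ^ 2) = (e * y) ^ 3 / (1 + e * y) := by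
        field_simp; ring
      have h3 : 0 ≤ (e * y) ^ 3 / (1 + e * y) := by positivity
      linarith
    linarith
  obtain ⟨M, hM⟩ : ∃ M, M = L / e := ⟨_, rfl⟩
  have hLM : L = e * M := by rw [hM]; field_simp
  have hM0 : 0 ≤ M := by rw [hM]; positivity
  have hM1 : M ≤ y := by rw [hM, div_le_iff₀ he]; linarith
  have hM2 : y - e * y ^ 2 ≤ M := by rw [hM, le_div_iff₀ he]; nlinarith
  have hform : (1 + 1 / e) * L = L + M := by rw [hM]; ring
  rw [hform]
  -- cubic bound
  have hB : (1 + y / 3) ≤ Real.exp (M / 3) := by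
    have hb := one_add_mul_self_le_rpow_one_add (s := e * y) (by linarith) (p := 1 / (3 * e))
      (by rw [le_div_iff₀ (by positivity)]; linarith)
    rw [Real.rpow_def_of_pos hpos, ← hL] at hb
    have q1 : 1 / (3 * e) * (e * y) = y / 3 := by field_simp
    have q2 : L * (1 / (3 * e)) = M / 3 := by rw [hM]; field_simp
    rwa [q1, q2] at hb
  have hB3 : y ^ 3 * Real.exp (-M) ≤ 27 := by
    have h3 : Real.exp M = Real.exp (M / 3) ^ 3 := by rw [← Real.exp_nat_mul]; congr 1; push_cast; ring
    have h4 : (y / 3) ^ 3 ≤ Real.exp M := by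
      rw [h3]; exact pow_le_pow_left₀ (by positivity) (by linarith) 3
    rw [Real.exp_neg, ← div_eq_mul_inv, div_le_iff₀ (Real.exp_pos _)]
    nlinarith
  have hS := aux_sq y hy
  rw [abs_le]
  constructor
  · have d1 := aux_diff y (L + M)
    have k : (L + M - y) * Real.exp (-y) ≤ (e * y) * Real.exp (-y) :=
      mul_le_mul_of_nonneg_right (by linarith) (Real.exp_pos _).le
    have := mul_le_mul_of_nonneg_left (d1.trans k) hy
    nlinarith
  · have d1 := aux_diff M y
    have m : Real.exp (-(L + M)) ≤ Real.exp (-M) := Real.exp_le_exp.2 (by linarith)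
    have k : (y - M) * Real.exp (-M) ≤ (e * y ^ 2) * Real.exp (-M) :=
      mul_le_mul_of_nonneg_right (by linarith) (Real.exp_pos _).le
    have h5 : Real.exp (-(L + M)) - Real.exp (-y) ≤ (e * y ^ 2) * Real.exp (-M) := by linarith
    have := mul_le_mul_of_nonneg_left h5 hy
    nlinarith

/-- The family of bacterial profiles U_d converges uniformly on ℝ to U₁ as d → 1⁺. -/
theorem unlimited_substrate_U_uniform_convergence
    (C0 k c τ μ Vinf B : ℝ)
    (hC0 : 0 < C0) (hk : 0 < k) (hc : 0 < c) (hτ : 0 < τ) (hμ : 0 < μ)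
    (hVinf : 0 < Vinf)
    (hB : B = C0 * k * μ / (2 * c ^ 2 * τ))
    (Vd : ℝ → ℝ → ℝ) (V1 : ℝ → ℝ) (Ud : ℝ → ℝ → ℝ) (U1 : ℝ → ℝ)
    (hVd : ∀ d : ℝ, 1 < d → ∀ ζ : ℝ, Vd d ζ =
      (B * (d - 1) * Real.exp (-(2 * τ * c * ζ) / μ)
        + Vinf ^ (-(d - 1))) ^ (-(1 / (d - 1))))
    (hUd : ∀ d : ℝ, 1 < d → ∀ ζ : ℝ, Ud d ζ =
      C0 * Vd d ζ ^ d * Real.exp (-(2 * τ * c * ζ) / μ))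
    (hV1 : ∀ ζ : ℝ, V1 ζ = Vinf * Real.exp (-B * Real.exp (-(2 * τ * c * ζ) / μ)))
    (hU1 : ∀ ζ : ℝ, U1 ζ = C0 * V1 ζ * Real.exp (-(2 * τ * c * ζ) / μ)) :
    TendstoUniformly Ud U1 (nhdsWithin 1 (Set.Ioi 1)) := by
  have hBpos : 0 < B := by rw [hB]; positivity
  have hK : 0 < C0 * Vinf / B := by positivity
  have key : ∀ d : ℝ, 1 < d → d ≤ 4 / 3 → 1 / 2 ≤ Vinf ^ (d - 1) → ∀ ζ, |Ud d ζ - U1 ζ| ≤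
      C0 * Vinf / B * (27 * (d - 1) + 10 * |Vinf ^ (d - 1) - 1|) := by
    intro d hd hd3 hW ζ
    obtain ⟨e, rfl⟩ : ∃ e, d = 1 + e := ⟨d - 1, by ring⟩
    rw [hUd _ hd, hVd _ hd, hU1, hV1]
    have he : 0 < e := by linarith
    have hee : 1 + e - 1 = e := by ring
    rw [hee] at hW ⊢
    generalize hx : Real.exp (-(2 * τ * c * ζ) / μ) = x
    have hx0 : 0 < x := by rw [← hx]; exact Real.exp_pos _
    set W := Vinf ^ e with hWdef
    have hW0 : 0 < W := by positivity
    have hneg : Vinf ^ (-e) = W⁻¹ := Real.rpow_neg hVinf.le e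
    have hlogW : Real.log W = e * Real.log Vinf := Real.log_rpow hVinf e
    have hp : 0 < 1 + e * (B * x * W) := by positivity
    have hA : B * e * x + Vinf ^ (-e) = (1 + e * (B * x * W)) / W := by
      rw [hneg]; field_simp; ring
    have hpow : ((B * e * x + Vinf ^ (-e)) ^ (-(1 / e))) ^ (1 + e)
        = Vinf * W * Real.exp (-((1 + 1 / e) * Real.log (1 + e * (B * x * W)))) := by
      have hA0 : 0 < (1 + e * (B * x * W)) / W := by positivity
      rw [hA, ← Real.rpow_mul hA0.le, Real.rpow_def_of_pos hA0, Real.log_div hp.ne' hW0.ne', hlogW]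
      have hVW : Vinf * W = Real.exp ((1 + e) * Real.log Vinf) := by
        rw [add_mul, Real.exp_add, one_mul, Real.exp_log hVinf, ← hlogW, Real.exp_log hW0]
      rw [hVW, ← Real.exp_add]
      congr 1
      field_simp
      ring
    rw [hpow]
    have m1 := aux_main e (B * x * W) he (by linarith) (by positivity)
    have m2 := aux_shift (B * x) W (by positivity) hW
    have m3 := (abs_sub_le _ _ _).trans (add_le_add m1 m2)
    have m4 := mul_le_mul_of_nonneg_left m3 hK.le
    refine le_of_eq_of_le ?_ m4
    conv_rhs => rw [← abs_of_pos hK, ← abs_mul]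
    congr 1
    rw [neg_mul]
    field_simp
  have hcont : Continuous (fun d : ℝ => Vinf ^ (d - 1)) :=
    Continuous.rpow continuous_const (by fun_prop) (fun _ => Or.inl hVinf.ne')
  have hWt : ∀ᶠ d in nhdsWithin (1:ℝ) (Set.Ioi 1), 1 / 2 ≤ Vinf ^ (d - 1) := by
    apply Filter.Eventually.filter_mono nhdsWithin_le_nhds
    have : (1/2 : ℝ) < Vinf ^ ((1:ℝ) - 1) := by norm_num
    exact (hcont.tendsto 1).eventually (eventually_ge_nhds this)
  have hbt : Tendsto (fun d : ℝ => C0 * Vinf / B * (27 * (d - 1) + 10 * |Vinf ^ (d - 1) - 1|))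
      (nhdsWithin 1 (Set.Ioi 1)) (nhds 0) := by
    apply Filter.Tendsto.mono_left _ nhdsWithin_le_nhds
    have hc2 : Continuous
        (fun d : ℝ => C0 * Vinf / B * (27 * (d - 1) + 10 * |Vinf ^ (d - 1) - 1|)) := by
      fun_prop
    have := hc2.tendsto 1
    simpa using this
  have h43 : ∀ᶠ d in nhdsWithin (1:ℝ) (Set.Ioi 1), d ≤ 4 / 3 :=
    Filter.Eventually.filter_mono nhdsWithin_le_nhds (eventually_le_nhds (by norm_num))
  rw [Metric.tendstoUniformly_iff]
  intro ε hε
  filter_upwards [hWt, h43, self_mem_nhdsWithin, hbt.eventually (eventually_lt_nhds hε)]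
    with d h1 h2 h3 h4 ζ
  rw [dist_comm, Real.dist_eq]
  exact (key d h3 h2 h1 ζ).trans_lt h4
end

section
/- The bacterial profile U has a single-peak shape: with ζ₀ = (μ/(2τc)) · ln( (C0·k·μ)/(2·c²·τ) · V∞^{d−1} ), the function U is strictly increasing on (−∞, ζ₀), strictly decreasing on (ζ₀, ∞), and attains its maximum value U(ζ₀) = (2·c²·τ·V∞)/(k·μ) · d^{−d/(d−1)}. -/
open Real Filter

lemma aux_deriv (a B d : ℝ) (ha : 0 < a) (hB : 0 < B) (hd : 1 < d) (x : ℝ) (hx : 0 < x) :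
    HasDerivAt (fun x : ℝ => x * (a * (d - 1) * x + B) ^ (-(d / (d - 1))))
      ((a * (d - 1) * x + B) ^ (-(d / (d - 1)) - 1) * (B - a * x)) x := by
  have h1 : 0 < d - 1 := by linarith
  have hpos : 0 < a * (d - 1) * x + B := by positivity
  have h : HasDerivAt (fun x : ℝ => a * (d - 1) * x + B) (a * (d - 1)) x := by
    simpa using ((hasDerivAt_id x).const_mul (a * (d - 1))).add_const B
  have h2 := (hasDerivAt_id x).mul (h.rpow_const (p := -(d / (d - 1))) (Or.inl hpos.ne'))
  refine h2.congr_deriv ?_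
  have e : (a * (d - 1) * x + B) ^ (-(d / (d - 1))) =
      (a * (d - 1) * x + B) ^ (-(d / (d - 1)) - 1) * (a * (d - 1) * x + B) := by
    rw [Real.rpow_sub_one hpos.ne']
    field_simp
  rw [e]
  simp only [id]
  generalize (a * (d - 1) * x + B) ^ (-(d / (d - 1)) - 1) = w
  field_simp
  ring

lemma aux_mono (a B d : ℝ) (ha : 0 < a) (hB : 0 < B) (hd : 1 < d) :
    StrictMonoOn (fun x : ℝ => x * (a * (d - 1) * x + B) ^ (-(d / (d - 1)))) (Set.Ioc 0 (B / a)) := by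
  have h1 : 0 < d - 1 := by linarith
  apply strictMonoOn_of_deriv_pos (convex_Ioc _ _)
  · intro x hx
    exact (aux_deriv a B d ha hB hd x hx.1).continuousAt.continuousWithinAt
  · intro x hx
    rw [interior_Ioc] at hx
    rw [(aux_deriv a B d ha hB hd x hx.1).deriv]
    have h0 := hx.1
    have := (lt_div_iff₀ ha).1 hx.2
    exact mul_pos (Real.rpow_pos_of_pos (by positivity) _) (by linarith)

lemma aux_anti (a B d : ℝ) (ha : 0 < a) (hB : 0 < B) (hd : 1 < d) :
    StrictAntiOn (fun x : ℝ => x * (a * (d - 1) * x + B) ^ (-(d / (d - 1)))) (Set.Ici (B / a)) := by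
  have h1 : 0 < d - 1 := by linarith
  have hBa : 0 < B / a := by positivity
  apply strictAntiOn_of_deriv_neg (convex_Ici _)
  · intro x hx
    exact (aux_deriv a B d ha hB hd x (hBa.trans_le hx)).continuousAt.continuousWithinAt
  · intro x hx
    rw [interior_Ici] at hx
    have h0 : 0 < x := hBa.trans hx
    rw [(aux_deriv a B d ha hB hd x h0).deriv]
    have := (div_lt_iff₀ ha).1 hx
    exact mul_neg_of_pos_of_neg (Real.rpow_pos_of_pos (by positivity) _) (by linarith)

/-- Single-peak shape of the bacterial profile U: strictly increasing on (−∞, ζ₀),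
strictly decreasing on (ζ₀, ∞), with maximum value (2c²τV∞)/(kμ)·d^{−d/(d−1)} at ζ₀. -/
theorem unlimited_substrate_U_shape
    (τ β μ k c Vinf C0 d ζ₀ : ℝ)
    (hτ : 0 < τ) (hβ : 0 < β) (hμ : 0 < μ) (hk : 0 < k) (hc : 0 < c)
    (hVinf : 0 < Vinf) (hC0 : 0 < C0)
    (hd : d = 2 * β / μ) (hd1 : 1 < d)
    (hζ₀ : ζ₀ = μ / (2 * τ * c) * Real.log (C0 * k * μ / (2 * c ^ 2 * τ) * Vinf ^ (d - 1)))
    (V U : ℝ → ℝ)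
    (hV : ∀ ζ : ℝ, V ζ =
      ((C0 * k * μ * (d - 1)) / (2 * c ^ 2 * τ) * Real.exp (-(2 * τ * c * ζ) / μ)
        + Vinf ^ (-(d - 1))) ^ (-(1 / (d - 1))))
    (hU : ∀ ζ : ℝ, U ζ = C0 * V ζ ^ d * Real.exp (-(2 * τ * c * ζ) / μ)) :
    StrictMonoOn U (Set.Iio ζ₀) ∧ StrictAntiOn U (Set.Ioi ζ₀) ∧
      U ζ₀ = 2 * c ^ 2 * τ * Vinf / (k * μ) * d ^ (-(d / (d - 1))) ∧
      ∀ ζ : ℝ, U ζ ≤ U ζ₀ := by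
  have h1 : 0 < d - 1 := by linarith
  obtain ⟨a, ha'⟩ : ∃ a, a = C0 * k * μ / (2 * c ^ 2 * τ) := ⟨_, rfl⟩
  obtain ⟨B, hB'⟩ : ∃ B, B = Vinf ^ (-(d - 1)) := ⟨_, rfl⟩
  have ha : 0 < a := by rw [ha']; positivity
  have hB : 0 < B := by rw [hB']; positivity
  obtain ⟨g, hg⟩ : ∃ g : ℝ → ℝ, g = fun x : ℝ => x * (a * (d - 1) * x + B) ^ (-(d / (d - 1))) :=
    ⟨_, rfl⟩
  have hm := aux_mono a B d ha hB hd1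
  have hn := aux_anti a B d ha hB hd1
  rw [← hg] at hm hn
  have hUg : ∀ ζ, U ζ = C0 * g (Real.exp (-(2 * τ * c * ζ) / μ)) := by
    intro ζ
    have hE := Real.exp_pos (-(2 * τ * c * ζ) / μ)
    rw [hU, hV, hg, ← hB', show C0 * k * μ * (d - 1) / (2 * c ^ 2 * τ) = a * (d - 1) by
      rw [ha']; ring, ← Real.rpow_mul (by positivity)]
    rw [show -(1 / (d - 1)) * d = -(d / (d - 1)) by ring]
    ring
  have hE0 : Real.exp (-(2 * τ * c * ζ₀) / μ) = B / a := by
    rw [← ha'] at hζ₀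
    have hp : 0 < a * Vinf ^ (d - 1) := by positivity
    rw [show -(2 * τ * c * ζ₀) / μ = -Real.log (a * Vinf ^ (d - 1)) by
      rw [hζ₀]; field_simp, Real.exp_neg, Real.exp_log hp, hB', Real.rpow_neg hVinf.le]
    field_simp
  have hE : ∀ x y : ℝ, x < y →
      Real.exp (-(2 * τ * c * y) / μ) < Real.exp (-(2 * τ * c * x) / μ) := by
    intro x y hxy
    apply Real.exp_lt_exp.2
    apply div_lt_div_of_pos_right _ hμ
    have : 2 * τ * c * x < 2 * τ * c * y := mul_lt_mul_of_pos_left hxy (by positivity)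
    linarith
  have M : StrictMonoOn U (Set.Iic ζ₀) := by
    intro x hx y hy hxy
    rw [hUg, hUg]
    have key : ∀ z ≤ ζ₀, B / a ≤ Real.exp (-(2 * τ * c * z) / μ) := by
      intro z hz
      rw [← hE0]
      rcases hz.lt_or_eq with h | h
      · exact (hE _ _ h).le
      · rw [h]
    exact mul_lt_mul_of_pos_left (hn (key y hy) (key x hx) (hE x y hxy)) hC0
  have N : StrictAntiOn U (Set.Ici ζ₀) := by
    intro x hx y hy hxy
    rw [hUg, hUg]
    have key : ∀ z, ζ₀ ≤ z → Real.exp (-(2 * τ * c * z) / μ) ∈ Set.Ioc 0 (B / a) := by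
      intro z hz
      refine ⟨Real.exp_pos _, ?_⟩
      rw [← hE0]
      rcases hz.lt_or_eq with h | h
      · exact (hE _ _ h).le
      · rw [h]
    exact mul_lt_mul_of_pos_left (hm (key y hy) (key x hx) (hE x y hxy)) hC0
  refine ⟨M.mono Set.Iio_subset_Iic_self, N.mono Set.Ioi_subset_Ici_self, ?_, ?_⟩
  · rw [hUg, hE0, hg]
    have e1 : a * (d - 1) * (B / a) + B = d * B := by field_simp; ring
    have e2 : B * B ^ (-(d / (d - 1))) = Vinf := by
      nth_rewrite 1 [← Real.rpow_one B]
      rw [← Real.rpow_add hB, hB', ← Real.rpow_mul hVinf.le]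
      rw [show -(d - 1) * (1 + -(d / (d - 1))) = 1 by field_simp; ring, Real.rpow_one]
    have e3 : C0 / a = 2 * c ^ 2 * τ / (k * μ) := by rw [ha']; field_simp
    simp only []
    rw [e1, Real.mul_rpow (by linarith) hB.le]
    calc _ = C0 / a * (B * B ^ (-(d / (d - 1)))) * d ^ (-(d / (d - 1))) := by ring
      _ = _ := by rw [e2, e3]; ring
  · intro ζ
    rcases le_total ζ ζ₀ with h | h
    · exact M.monotoneOn h (Set.mem_Iic.2 le_rfl) h
    · exact N.antitoneOn (Set.mem_Ici.2 le_rfl) h h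
end

section
/- The substrate profile V is strictly increasing on ℝ, with V(ζ) → 0 as ζ → −∞ and V(ζ) → V∞ as ζ → ∞. -/
open Real Filter

/-- The substrate profile V is strictly increasing, tends to 0 at −∞ and to V∞ at ∞. -/
theorem unlimited_substrate_V_shape
    (τ β μ k c Vinf C0 d : ℝ)
    (hτ : 0 < τ) (hβ : 0 < β) (hμ : 0 < μ) (hk : 0 < k) (hc : 0 < c)
    (hVinf : 0 < Vinf) (hC0 : 0 < C0)
    (hd : d = 2 * β / μ) (hd1 : 1 < d)
    (V : ℝ → ℝ)
    (hV : ∀ ζ : ℝ, V ζ =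
      ((C0 * k * μ * (d - 1)) / (2 * c ^ 2 * τ) * Real.exp (-(2 * τ * c * ζ) / μ)
        + Vinf ^ (-(d - 1))) ^ (-(1 / (d - 1)))) :
    StrictMono V ∧ Tendsto V atBot (nhds 0) ∧ Tendsto V atTop (nhds Vinf) := by
  have hd0 : 0 < d - 1 := by linarith
  have hA : 0 < (C0 * k * μ * (d - 1)) / (2 * c ^ 2 * τ) := by positivity
  have hB : 0 < Vinf ^ (-(d - 1)) := Real.rpow_pos_of_pos hVinf _
  have hp : 0 < 1 / (d - 1) := by positivity
  have hr : 0 < 2 * τ * c / μ := by positivity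
  have hlim : Vinf = (Vinf ^ (-(d - 1))) ^ (-(1 / (d - 1))) := by
    rw [← Real.rpow_mul hVinf.le]
    have h1 : -(d - 1) * -(1 / (d - 1)) = 1 := by field_simp
    rw [h1, Real.rpow_one]
  have harg : ∀ ζ : ℝ, -(2 * τ * c * ζ) / μ = -(2 * τ * c / μ * ζ) := by
    intro ζ
    ring
  simp only [harg] at hV
  generalize (C0 * k * μ * (d - 1)) / (2 * c ^ 2 * τ) = A at *
  generalize 2 * τ * c / μ = r at *
  generalize Vinf ^ (-(d - 1)) = B at *
  generalize 1 / (d - 1) = p at *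
  obtain rfl : V = fun ζ => (A * Real.exp (-(r * ζ)) + B) ^ (-p) := funext hV
  refine ⟨?_, ?_, ?_⟩
  · intro x y hxy
    have h1 : Real.exp (-(r * y)) < Real.exp (-(r * x)) := by
      apply Real.exp_lt_exp.mpr
      have := mul_lt_mul_of_pos_left hxy hr
      linarith
    have h2 := mul_lt_mul_of_pos_left h1 hA
    have h3 : 0 < A * Real.exp (-(r * y)) := by positivity
    exact Real.rpow_lt_rpow_of_neg (by linarith) (by linarith) (by linarith)
  · have h1 : Tendsto (fun ζ : ℝ => -(r * ζ)) atBot atTop :=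
      tendsto_neg_atBot_atTop.comp (tendsto_id.const_mul_atBot hr)
    have h2 := tendsto_atTop_add_const_right _ B
      ((Real.tendsto_exp_atTop.comp h1).const_mul_atTop hA)
    exact (tendsto_rpow_neg_atTop hp).comp h2
  · have h1 : Tendsto (fun ζ : ℝ => -(r * ζ)) atTop atBot :=
      tendsto_neg_atTop_atBot.comp (tendsto_id.const_mul_atTop hr)
    have h2 := ((Real.tendsto_exp_atBot.comp h1).const_mul A).add_const B
    rw [mul_zero, zero_add] at h2
    have h3 := h2.rpow_const (p := -p) (Or.inl hB.ne')
    rw [← hlim] at h3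
    exact h3
end

section
/- The pair (U, V) is a traveling-band solution of the reduced chemotaxis system with limited substrate: for every ζ ∈ ℝ one has τ c U′(ζ) − β (U·V′/V)′(ζ) + (μ/2) U″(ζ) = 0 and c V′(ζ) − k U(ζ) V(ζ) = 0; moreover U(ζ) → 0, U′(ζ) → 0 and V(ζ) → V∞ as ζ → ∞. -/
open Real Filter

/-- The pair (U, V) is a traveling-band solution of the reduced chemotaxis system
with limited substrate, with the boundary conditions at +∞. -/
theorem limited_substrate_traveling_band
    (τ β μ k c Vinf C0 : ℝ)
    (hτ : 0 < τ) (hβ : 0 < β) (hμ : 0 < μ) (hk : 0 < k) (hc : 0 < c)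
    (hVinf : 0 < Vinf) (hC0 : 1 < C0)
    (U V : ℝ → ℝ)
    (hU : ∀ ζ : ℝ, U ζ = τ * c ^ 2 / (β * k) * (1 + C0 * Real.exp (2 * τ * c * ζ / μ))⁻¹)
    (hV : ∀ ζ : ℝ, V ζ =
      Vinf * (1 + C0⁻¹ * Real.exp (-(2 * τ * c * ζ) / μ)) ^ (-(μ / (2 * β)))) :
    (∀ ζ : ℝ,
      τ * c * deriv U ζ - β * deriv (fun s => U s * deriv V s / V s) ζ
          + μ / 2 * deriv (deriv U) ζ = 0 ∧
      c * deriv V ζ - k * U ζ * V ζ = 0) ∧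
    Tendsto U atTop (nhds 0) ∧ Tendsto (deriv U) atTop (nhds 0) ∧
      Tendsto V atTop (nhds Vinf) := by
  have hC : 0 < C0 := by linarith
  have dU : ∀ ζ, HasDerivAt U (2 / μ * (β * k / c * U ζ ^ 2 - τ * c * U ζ)) ζ := by
    intro ζ
    have hE := Real.exp_pos (2 * τ * c * ζ / μ)
    have hpos : 0 < 1 + C0 * Real.exp (2 * τ * c * ζ / μ) := by positivity
    have h1 : HasDerivAt (fun s : ℝ => 2 * τ * c * s / μ) (2 * τ * c * 1 / μ) ζ :=
      ((hasDerivAt_id' ζ).const_mul (2 * τ * c)).div_const μ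
    have h2 := (((h1.exp.const_mul C0).const_add 1).fun_inv hpos.ne').const_mul
      (τ * c ^ 2 / (β * k))
    have h3 : U = fun s => τ * c ^ 2 / (β * k) * (1 + C0 * Real.exp (2 * τ * c * s / μ))⁻¹ :=
      funext hU
    rw [h3]
    refine h2.congr_deriv ?_
    simp only []
    generalize Real.exp (2 * τ * c * ζ / μ) = E at *
    field_simp
    ring
  have dV : ∀ ζ, HasDerivAt V (k / c * U ζ * V ζ) ζ := by
    intro ζ
    have hE := Real.exp_pos (2 * τ * c * ζ / μ)
    have hE' := Real.exp_pos (-(2 * τ * c * ζ) / μ)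
    have hpos : 0 < 1 + C0⁻¹ * Real.exp (-(2 * τ * c * ζ) / μ) := by positivity
    have h1 : HasDerivAt (fun s : ℝ => -(2 * τ * c * s) / μ) (-(2 * τ * c * 1) / μ) ζ :=
      (((hasDerivAt_id' ζ).const_mul (2 * τ * c)).fun_neg).div_const μ
    have h2 := (((h1.exp.const_mul C0⁻¹).const_add 1).rpow_const
      (p := -(μ / (2 * β))) (Or.inl hpos.ne')).const_mul Vinf
    have h3 : V = fun s => Vinf * (1 + C0⁻¹ * Real.exp (-(2 * τ * c * s) / μ)) ^ (-(μ / (2 * β))) :=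
      funext hV
    have h4 : Real.exp (-(2 * τ * c * ζ) / μ) = (Real.exp (2 * τ * c * ζ / μ))⁻¹ := by
      rw [← Real.exp_neg]; congr 1; ring
    rw [hU, h3]
    refine h2.congr_deriv ?_
    simp only []
    rw [Real.rpow_sub_one hpos.ne']
    generalize (1 + C0⁻¹ * Real.exp (-(2 * τ * c * ζ) / μ)) ^ (-(μ / (2 * β))) = W
    rw [h4] at hpos ⊢
    generalize Real.exp (2 * τ * c * ζ / μ) = E at *
    have : 0 < 1 + C0 * E := by positivity
    have : 0 < C0 * E + 1 := by positivity
    field_simp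
    try ring
  have Vpos : ∀ ζ, V ζ ≠ 0 := by
    intro ζ
    rw [hV]
    have hE' := Real.exp_pos (-(2 * τ * c * ζ) / μ)
    positivity
  have eU : deriv U = fun ζ => 2 / μ * (β * k / c * U ζ ^ 2 - τ * c * U ζ) :=
    funext fun ζ => (dU ζ).deriv
  have eW : (fun s => U s * deriv V s / V s) = fun s => k / c * U s ^ 2 := by
    funext s
    rw [(dV s).deriv]
    have := Vpos s
    field_simp
  have lin : Tendsto (fun ζ : ℝ => 2 * τ * c * ζ / μ) atTop atTop :=
    (tendsto_id.const_mul_atTop (by positivity : 0 < 2 * τ * c)).atTop_div_const hμ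
  have tU : Tendsto U atTop (nhds 0) := by
    have h3 : U = fun s => τ * c ^ 2 / (β * k) * (1 + C0 * Real.exp (2 * τ * c * s / μ))⁻¹ :=
      funext hU
    rw [h3]
    have h := (tendsto_inv_atTop_zero.comp (tendsto_atTop_add_const_left _ 1
      ((Real.tendsto_exp_atTop.comp lin).const_mul_atTop hC))).const_mul (τ * c ^ 2 / (β * k))
    simpa [Function.comp_def] using h
  refine ⟨fun ζ => ⟨?_, ?_⟩, tU, ?_, ?_⟩
  · have h2 := ((((dU ζ).fun_pow 2).const_mul (β * k / c)).fun_sub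
      ((dU ζ).const_mul (τ * c))).const_mul (2 / μ)
    have h5 := ((dU ζ).fun_pow 2).const_mul (k / c)
    rw [eW, eU, h2.deriv, h5.deriv]
    field_simp
    ring
  · rw [(dV ζ).deriv]
    field_simp
    ring
  · rw [eU]
    have h := (((tU.pow 2).const_mul (β * k / c)).sub (tU.const_mul (τ * c))).const_mul (2 / μ)
    simpa using h
  · have h3 : V = fun s => Vinf * (1 + C0⁻¹ * Real.exp (-(2 * τ * c * s) / μ)) ^ (-(μ / (2 * β))) :=
      funext hV
    rw [h3]
    have l2 : Tendsto (fun ζ : ℝ => -(2 * τ * c * ζ) / μ) atTop atBot := by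
      have := tendsto_neg_atTop_atBot.comp lin
      simpa [Function.comp_def, neg_div] using this
    have h := (((Real.tendsto_exp_atBot.comp l2).const_mul C0⁻¹).const_add 1)
    have h' := (h.rpow_const (p := -(μ / (2 * β))) (Or.inl (by norm_num))).const_mul Vinf
    simpa [Function.comp_def] using h'
end

section
/- Linear instability criterion: if a > (v₀/(16·u₀)) · (μ/β) · (D·π²/L² + 8·d), then c < 0, the discriminant b² − 4c is positive, and σ := (−b + √(b² − 4c))/2 is a positive real root of the dispersion relation σ² + b·σ + c = 0; in particular the perturbation mode grows exponentially in time. -/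
open Real Filter

/-- Linear instability criterion: if the substrate production rate a exceeds the
threshold (v₀/(16u₀))·(μ/β)·(Dπ²/L² + 8d), then for the lowest mode λ = π/(2L)
the dispersion relation σ² + bσ + c = 0 has c < 0, positive discriminant, and a
positive real root σ, so the perturbation mode grows exponentially in time. -/
theorem linear_instability_criterion
    (μ D τ β u₀ v₀ a d L lam b c σ : ℝ)
    (hμ : 0 < μ) (hD : 0 < D) (hτ : 0 < τ) (hβ : 0 < β)
    (hu₀ : 0 < u₀) (hv₀ : 0 < v₀) (ha : 0 < a) (hd : 0 < d) (hL : 0 < L)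
    (hlam : lam = π / (2 * L))
    (hb : b = (1 / τ) * (D / 2 * lam ^ 2 + μ / 2 * lam ^ 2 + d))
    (hc : c = lam ^ 2 / τ ^ 2 * (μ * D / 4 * lam ^ 2 + μ * d / 2 - a * β * u₀ / v₀))
    (hσ : σ = (-b + Real.sqrt (b ^ 2 - 4 * c)) / 2)
    (hcrit : a > v₀ / (16 * u₀) * (μ / β) * (D * π ^ 2 / L ^ 2 + 8 * d)) :
    c < 0 ∧ 0 < b ^ 2 - 4 * c ∧ 0 < σ ∧ σ ^ 2 + b * σ + c = 0 ∧
      Tendsto (fun t : ℝ => Real.exp (σ * t)) atTop atTop := by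
  have hlp : 0 < lam := by rw [hlam]; positivity
  have hbp : 0 < b := by rw [hb]; positivity
  have hk : 0 < β * u₀ / v₀ := by positivity
  have h1 := mul_lt_mul_of_pos_right hcrit hk
  have h2 : v₀ / (16 * u₀) * (μ / β) * (D * π ^ 2 / L ^ 2 + 8 * d) * (β * u₀ / v₀)
      = μ * D / 4 * lam ^ 2 + μ * d / 2 := by
    rw [hlam]; field_simp; ring
  have h3 : a * (β * u₀ / v₀) = a * β * u₀ / v₀ := by ring
  have hcn : c < 0 := by
    rw [hc]
    apply mul_neg_of_pos_of_neg
    · positivity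
    · linarith
  have hdisc : 0 < b ^ 2 - 4 * c := by nlinarith [sq_nonneg b]
  have hs : b < Real.sqrt (b ^ 2 - 4 * c) := by
    apply Real.lt_sqrt_of_sq_lt
    linarith
  have hsp : 0 < σ := by rw [hσ]; linarith
  refine ⟨hcn, hdisc, hsp, ?_, ?_⟩
  · have hq := Real.sq_sqrt hdisc.le
    rw [hσ]
    linear_combination hq / 4
  · exact Real.tendsto_exp_atTop.comp (tendsto_id.const_mul_atTop hsp)
end

section
/- L²-exponential stability of the linearized chemotaxis system: assume (2u₀/v₀)·β ≤ μ, (2u₀/v₀)·β ≤ D, 4a ≤ C_p·μ, and 4a ≤ C_p·D + d, where C_p = 2/L². Then, with A := min( C_p·μ/4, C_p·D/4 + 7d/4 )/τ, every solution (u, v) satisfies ∫₀ᴸ ( u(x,t)² + v(x,t)² ) dx ≤ e^{−A t} · ∫₀ᴸ ( u(x,0)² + v(x,0)² ) dx for all t ≥ 0. -/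
open Real Filter Set intervalIntegral

lemma aux_ftc {L : ℝ} (hL : 0 ≤ L) {f f' : ℝ → ℝ}
    (hf : ∀ x ∈ Icc 0 L, HasDerivWithinAt f (f' x) (Icc 0 L) x)
    (hc : ContinuousOn f' (Icc 0 L)) {x : ℝ} (hx : x ∈ Icc 0 L) :
    ∫ y in (0:ℝ)..x, f' y = f x - f 0 := by
  have hsub : Icc 0 x ⊆ Icc 0 L := Icc_subset_Icc le_rfl hx.2
  apply integral_eq_sub_of_hasDerivAt_of_le hx.1
  · exact fun y hy => ((hf y (hsub hy)).continuousWithinAt).mono hsub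
  · intro y hy
    exact (hf y (hsub (Ioo_subset_Icc_self hy))).hasDerivAt
      (Icc_mem_nhds hy.1 (hy.2.trans_le hx.2))
  · exact (hc.mono hsub).intervalIntegrable_of_Icc hx.1

lemma aux_poincare {L : ℝ} (hL : 0 < L) {f f' : ℝ → ℝ}
    (hf : ∀ x ∈ Icc 0 L, HasDerivWithinAt f (f' x) (Icc 0 L) x)
    (hc : ContinuousOn f' (Icc 0 L)) (h0 : f 0 = 0) :
    2 / L ^ 2 * ∫ x in (0:ℝ)..L, f x ^ 2 ≤ ∫ x in (0:ℝ)..L, f' x ^ 2 := by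
  have hfc : ContinuousOn f (Icc 0 L) := fun y hy => (hf y hy).continuousWithinAt
  set I := ∫ x in (0:ℝ)..L, f' x ^ 2 with hI
  have key : ∀ x ∈ Icc 0 L, f x ^ 2 ≤ x * I := by
    intro x hx
    rcases hx.1.eq_or_lt with h | hxpos
    · subst h; simp [h0]
    have hsub : Icc 0 x ⊆ Icc 0 L := Icc_subset_Icc le_rfl hx.2
    have h1 := aux_ftc hL.le hf hc hx
    rw [h0, sub_zero] at h1
    have i1 : IntervalIntegrable f' MeasureTheory.volume 0 x :=
      (hc.mono hsub).intervalIntegrable_of_Icc hx.1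
    have i2 : IntervalIntegrable (fun y => f' y ^ 2) MeasureTheory.volume 0 x :=
      ((hc.pow 2).mono hsub).intervalIntegrable_of_Icc hx.1
    have h2 : 0 ≤ ∫ y in (0:ℝ)..x, (x * f' y - f x) ^ 2 :=
      integral_nonneg hx.1 (fun y _ => sq_nonneg _)
    have h3 : ∫ y in (0:ℝ)..x, (x * f' y - f x) ^ 2
        = x ^ 2 * (∫ y in (0:ℝ)..x, f' y ^ 2) - 2 * x * f x * (∫ y in (0:ℝ)..x, f' y)
          + x * f x ^ 2 := by
      have : ∀ y, (x * f' y - f x) ^ 2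
        = x ^ 2 * f' y ^ 2 - 2 * x * f x * f' y + f x ^ 2 := fun y => by ring
      simp_rw [this]
      rw [integral_add ((i2.const_mul _).sub (i1.const_mul _)) (by simp),
        integral_sub (i2.const_mul _) (i1.const_mul _), integral_const_mul, integral_const_mul]
      simp
    have h4 : (∫ y in (0:ℝ)..x, f' y ^ 2) ≤ I := by
      apply integral_mono_interval le_rfl hx.1 hx.2
      · exact Eventually.of_forall fun y => sq_nonneg _
      · exact (hc.pow 2).intervalIntegrable_of_Icc hL.le
    rw [h3, h1] at h2
    have h5 : 0 ≤ x * (x * (∫ y in (0:ℝ)..x, f' y ^ 2) - f x ^ 2) := by nlinarith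
    have h6 := nonneg_of_mul_nonneg_right h5 hxpos
    nlinarith
  have h7 : (∫ x in (0:ℝ)..L, f x ^ 2) ≤ ∫ x in (0:ℝ)..L, x * I := by
    apply integral_mono_on hL.le
    · exact (hfc.pow 2).intervalIntegrable_of_Icc hL.le
    · exact (by fun_prop : Continuous fun x : ℝ => x * I).intervalIntegrable _ _
    · exact key
  rw [integral_mul_const, integral_id] at h7
  rw [div_mul_eq_mul_div, div_le_iff₀ (by positivity)]
  nlinarith

lemma aux_ext {L : ℝ} (hL : 0 ≤ L) {w : ℝ → ℝ → ℝ}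
    (hw : ContinuousOn (fun p : ℝ × ℝ => w p.1 p.2) (Icc 0 L ×ˢ Ici 0)) :
    ∃ W : ℝ → ℝ → ℝ, Continuous (fun p : ℝ × ℝ => W p.1 p.2) ∧
      ∀ x ∈ Icc 0 L, ∀ t ∈ Ici (0:ℝ), W x t = w x t := by
  refine ⟨fun x t => w (max 0 (min x L)) (max 0 t), ?_, ?_⟩
  · exact hw.comp_continuous (f := fun p : ℝ × ℝ => (max 0 (min p.1 L), max 0 p.2))
      (by fun_prop) (fun p => ⟨⟨le_max_left _ _, max_le hL (min_le_right _ _)⟩, mem_Ici.2 (le_max_left _ _)⟩)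
  · intro x hx t ht
    simp only [min_eq_left hx.2, max_eq_right hx.1, max_eq_right (mem_Ici.1 ht)]

lemma aux_param {L : ℝ} (hL : 0 ≤ L) {w wt : ℝ → ℝ → ℝ}
    (hw : ContinuousOn (fun p : ℝ × ℝ => w p.1 p.2) (Icc 0 L ×ˢ Ici 0))
    (hwt : ContinuousOn (fun p : ℝ × ℝ => wt p.1 p.2) (Icc 0 L ×ˢ Ici 0))
    (hd : ∀ x ∈ Icc 0 L, ∀ t ∈ Ici (0:ℝ),
      HasDerivWithinAt (fun s => w x s) (wt x t) (Ici 0) t) :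
    ContinuousOn (fun t => ∫ x in (0:ℝ)..L, w x t) (Ici 0) ∧
    ∀ t ∈ Ioi (0:ℝ), HasDerivAt (fun t => ∫ x in (0:ℝ)..L, w x t)
      (∫ x in (0:ℝ)..L, wt x t) t := by
  obtain ⟨W, hWc, hW⟩ := aux_ext hL hw
  obtain ⟨W', hWc', hW'⟩ := aux_ext hL hwt
  have sl : ∀ {V : ℝ → ℝ → ℝ}, Continuous (fun p : ℝ × ℝ => V p.1 p.2) → ∀ t,
      Continuous (fun x => V x t) := fun h t =>
    h.comp (by fun_prop : Continuous fun x : ℝ => (x, t))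
  have e : ∀ t ∈ Ici (0:ℝ), ∫ x in (0:ℝ)..L, w x t = ∫ x in (0:ℝ)..L, W x t := by
    intro t ht
    apply integral_congr
    intro x hx
    rw [uIcc_of_le hL] at hx
    exact (hW x hx t ht).symm
  have e' : ∀ t ∈ Ici (0:ℝ), ∫ x in (0:ℝ)..L, wt x t = ∫ x in (0:ℝ)..L, W' x t := by
    intro t ht
    apply integral_congr
    intro x hx
    rw [uIcc_of_le hL] at hx
    exact (hW' x hx t ht).symm
  constructor
  · refine ContinuousOn.congr (f := fun t => ∫ x in (0:ℝ)..L, W x t) ?_ e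
    apply Continuous.continuousOn
    apply intervalIntegral.continuous_parametric_intervalIntegral_of_continuous'
    exact hWc.comp continuous_swap
  · intro t ht
    have ht' : (0:ℝ) < t := ht
    rw [e' t ht'.le]
    have hev : (fun t => ∫ x in (0:ℝ)..L, w x t) =ᶠ[nhds t] fun t => ∫ x in (0:ℝ)..L, W x t := by
      filter_upwards [Ioi_mem_nhds ht'] with s hs using e s (mem_Ioi.1 hs).le
    refine HasDerivAt.congr_of_eventuallyEq ?_ hev
    obtain ⟨C, hC⟩ := ((isCompact_Icc (a := (0:ℝ)) (b := L)).prod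
      (isCompact_Icc (a := (0:ℝ)) (b := t + 1))).exists_bound_of_continuousOn hWc'.continuousOn
    refine (intervalIntegral.hasDerivAt_integral_of_dominated_loc_of_deriv_le
      (F := fun t x => W x t) (F' := fun t x => W' x t) (bound := fun _ => C)
      (s := Ioo 0 (t+1)) (Ioo_mem_nhds ht' (by linarith)) ?_ ?_ ?_ ?_ ?_ ?_).2
    · exact Eventually.of_forall fun s => (sl hWc s).aestronglyMeasurable
    · exact (sl hWc t).intervalIntegrable _ _
    · exact (sl hWc' t).aestronglyMeasurable
    · refine Eventually.of_forall fun x hx s hs => ?_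
      rw [uIoc_of_le hL] at hx
      exact hC (x, s) ⟨Ioc_subset_Icc_self hx, Ioo_subset_Icc_self hs⟩
    · simp
    · refine Eventually.of_forall fun x hx s hs => ?_
      rw [uIoc_of_le hL] at hx
      have hx' := Ioc_subset_Icc_self hx
      rw [hW' x hx' s hs.1.le]
      refine ((hd x hx' s hs.1.le).hasDerivAt (Ici_mem_nhds hs.1)).congr_of_eventuallyEq ?_
      filter_upwards [Ioi_mem_nhds hs.1] with r hr using hW x hx' r (mem_Ioi.1 hr).le

/-- L²-exponential stability of the linearized chemotaxis system on [0,L] with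
mixed Dirichlet (at x = 0) and Neumann (at x = L) boundary conditions:
under the conditions (2u₀/v₀)β ≤ μ, (2u₀/v₀)β ≤ D, 4a ≤ C_pμ, 4a ≤ C_pD + d
with C_p = 2/L², the L²-energy decays exponentially with rate
A = min(C_pμ/4, C_pD/4 + 7d/4)/τ. -/
theorem linearized_chemotaxis_L2_stability
    (τ μ D β u₀ v₀ a d L Cp A : ℝ)
    (hτ : 0 < τ) (hμ : 0 < μ) (hD : 0 < D) (hβ : 0 < β)
    (hu₀ : 0 < u₀) (hv₀ : 0 < v₀) (ha : 0 < a) (hd : 0 < d) (hL : 0 < L)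
    (hCp : Cp = 2 / L ^ 2)
    (hcond1 : 2 * u₀ / v₀ * β ≤ μ) (hcond2 : 2 * u₀ / v₀ * β ≤ D)
    (hcond3 : 4 * a ≤ Cp * μ) (hcond4 : 4 * a ≤ Cp * D + d)
    (hA : A = min (Cp * μ / 4) (Cp * D / 4 + 7 * d / 4) / τ)
    -- the solution (u, v) together with its partial derivatives
    (u v ut ux uxx vt vx vxx : ℝ → ℝ → ℝ)
    (hut : ∀ x ∈ Icc 0 L, ∀ t ∈ Ici (0:ℝ),
      HasDerivWithinAt (fun s => u x s) (ut x t) (Ici 0) t)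
    (hvt : ∀ x ∈ Icc 0 L, ∀ t ∈ Ici (0:ℝ),
      HasDerivWithinAt (fun s => v x s) (vt x t) (Ici 0) t)
    (hux : ∀ t ∈ Ici (0:ℝ), ∀ x ∈ Icc 0 L,
      HasDerivWithinAt (fun y => u y t) (ux x t) (Icc 0 L) x)
    (hvx : ∀ t ∈ Ici (0:ℝ), ∀ x ∈ Icc 0 L,
      HasDerivWithinAt (fun y => v y t) (vx x t) (Icc 0 L) x)
    (huxx : ∀ t ∈ Ici (0:ℝ), ∀ x ∈ Icc 0 L,
      HasDerivWithinAt (fun y => ux y t) (uxx x t) (Icc 0 L) x)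
    (hvxx : ∀ t ∈ Ici (0:ℝ), ∀ x ∈ Icc 0 L,
      HasDerivWithinAt (fun y => vx y t) (vxx x t) (Icc 0 L) x)
    -- twice continuous differentiability: continuity of the solution and its partials
    (hcont : ∀ f ∈ ([u, v, ut, ux, uxx, vt, vx, vxx] : List (ℝ → ℝ → ℝ)),
      ContinuousOn (fun p : ℝ × ℝ => f p.1 p.2) (Icc 0 L ×ˢ Ici 0))
    -- the linearized PDE system on (0,L) × (0,∞)
    (hpde1 : ∀ x ∈ Ioo 0 L, ∀ t ∈ Ioi (0:ℝ),
      τ * ut x t + u₀ / v₀ * β * vxx x t - μ / 2 * uxx x t = 0)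
    (hpde2 : ∀ x ∈ Ioo 0 L, ∀ t ∈ Ioi (0:ℝ),
      τ * vt x t - D / 2 * vxx x t - a * u x t + d * v x t = 0)
    -- mixed Dirichlet–Neumann boundary conditions
    (hbc : ∀ t ∈ Ici (0:ℝ), u 0 t = 0 ∧ v 0 t = 0 ∧ ux L t = 0 ∧ vx L t = 0) :
    ∀ t ∈ Ici (0:ℝ),
      (∫ x in (0:ℝ)..L, ((u x t) ^ 2 + (v x t) ^ 2)) ≤
        Real.exp (-A * t) * ∫ x in (0:ℝ)..L, ((u x 0) ^ 2 + (v x 0) ^ 2) := by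
  have cu := hcont u (by simp)
  have cv := hcont v (by simp)
  have cut := hcont ut (by simp)
  have cux := hcont ux (by simp)
  have cuxx := hcont uxx (by simp)
  have cvt := hcont vt (by simp)
  have cvx := hcont vx (by simp)
  have cvxx := hcont vxx (by simp)
  clear hcont
  obtain ⟨hVc, hVd⟩ := aux_param (L := L) hL.le (w := fun x t => u x t ^ 2 + v x t ^ 2)
    (wt := fun x t => 2 * u x t * ut x t + 2 * v x t * vt x t)
    ((cu.pow 2).add (cv.pow 2))
    (((continuousOn_const.mul cu).mul cut).add ((continuousOn_const.mul cv).mul cvt))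
    (by
      intro x hx t ht
      refine (((hut x hx t ht).pow 2).add ((hvt x hx t ht).pow 2)).congr_deriv ?_
      simp)
  set V : ℝ → ℝ := fun t => ∫ x in (0:ℝ)..L, (u x t ^ 2 + v x t ^ 2) with hV
  have main : ∀ t ∈ Ioi (0:ℝ),
      (∫ x in (0:ℝ)..L, (2 * u x t * ut x t + 2 * v x t * vt x t)) ≤ - A * V t := by
    intro t ht
    have ht0 : t ∈ Ici (0:ℝ) := le_of_lt (mem_Ioi.1 ht)
    have sl : ∀ {f : ℝ → ℝ → ℝ},
        ContinuousOn (fun p : ℝ × ℝ => f p.1 p.2) (Icc 0 L ×ˢ Ici 0) →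
        ContinuousOn (fun x => f x t) (Icc 0 L) := fun h =>
      h.comp (f := fun x : ℝ => (x, t)) (by fun_prop) (fun x hx => ⟨hx, ht0⟩)
    replace cu := sl cu
    replace cv := sl cv
    replace cut := sl cut
    replace cux := sl cux
    replace cuxx := sl cuxx
    replace cvt := sl cvt
    replace cvx := sl cvx
    replace cvxx := sl cvxx
    obtain ⟨b1, b2, b3, b4⟩ := hbc t ht0
    have P1 := aux_poincare hL (hux t ht0) cux b1
    have P2 := aux_poincare hL (hvx t ht0) cvx b2
    rw [← hCp] at P1 P2
    have ii : ∀ {f : ℝ → ℝ}, ContinuousOn f (Icc 0 L) →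
        IntervalIntegrable f MeasureTheory.volume 0 L := fun h =>
      h.intervalIntegrable_of_Icc hL.le
    set k := u₀ / v₀ * β with hk
    have hkpos : 0 < k := by positivity
    have k1 : 2 * k ≤ μ := by rw [hk]; convert hcond1 using 1; ring
    have k2 : 2 * k ≤ D := by rw [hk]; convert hcond2 using 1; ring
    set G' : ℝ → ℝ := fun x => μ * (ux x t * ux x t + u x t * uxx x t)
      + D * (vx x t * vx x t + v x t * vxx x t)
      - 2 * k * (ux x t * vx x t + u x t * vxx x t) with hG'
    have cG : ContinuousOn G' (Icc 0 L) := by fun_prop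
    have hG := aux_ftc hL.le (f := fun x => μ * (u x t * ux x t) + D * (v x t * vx x t)
        - 2 * k * (u x t * vx x t)) (f' := G')
      (fun x hx => (((((hux t ht0 x hx).mul (huxx t ht0 x hx)).const_mul μ).add
        (((hvx t ht0 x hx).mul (hvxx t ht0 x hx)).const_mul D)).sub
        (((hux t ht0 x hx).mul (hvxx t ht0 x hx)).const_mul (2 * k)))) cG
      (right_mem_Icc.2 hL.le)
    simp only [b1, b2, b3, b4, mul_zero, zero_mul, add_zero, sub_zero] at hG
    have hmono : (∫ x in (0:ℝ)..L, τ * (2 * u x t * ut x t + 2 * v x t * vt x t)) ≤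
        ∫ x in (0:ℝ)..L, (G' x - μ / 2 * ux x t ^ 2 - D / 2 * vx x t ^ 2
          + a * u x t ^ 2 + (a - 2 * d) * v x t ^ 2) := by
      apply integral_mono_on_of_le_Ioo hL.le
      · exact ii (by fun_prop)
      · exact ii (by fun_prop)
      · intro x hx
        have e1 := hpde1 x hx t ht
        have e2 := hpde2 x hx t ht
        have e3 : τ * (2 * u x t * ut x t + 2 * v x t * vt x t)
          = G' x - μ * ux x t ^ 2 - D * vx x t ^ 2 + 2 * k * (ux x t * vx x t)
            + 2 * a * (u x t * v x t) - 2 * d * v x t ^ 2 := by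
          simp only [hG']
          linear_combination (2 * u x t) * e1 + (2 * v x t) * e2
        rw [e3]
        have q1 := mul_nonneg hkpos.le (sq_nonneg (ux x t - vx x t))
        have q2 := mul_nonneg ha.le (sq_nonneg (u x t - v x t))
        have q3 := mul_nonneg (sub_nonneg.2 k1) (sq_nonneg (ux x t))
        have q4 := mul_nonneg (sub_nonneg.2 k2) (sq_nonneg (vx x t))
        nlinarith
    have i1 : IntervalIntegrable (fun x => ux x t ^ 2) MeasureTheory.volume 0 L := ii (by fun_prop)
    have i2 : IntervalIntegrable (fun x => vx x t ^ 2) MeasureTheory.volume 0 L := ii (by fun_prop)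
    have i3 : IntervalIntegrable (fun x => u x t ^ 2) MeasureTheory.volume 0 L := ii (by fun_prop)
    have i4 : IntervalIntegrable (fun x => v x t ^ 2) MeasureTheory.volume 0 L := ii (by fun_prop)
    have iG := ii cG
    rw [integral_const_mul,
      integral_add ((((iG.sub (i1.const_mul _)).sub (i2.const_mul _))).add (i3.const_mul _))
        (i4.const_mul _),
      integral_add (((iG.sub (i1.const_mul _)).sub (i2.const_mul _))) (i3.const_mul _),
      integral_sub (iG.sub (i1.const_mul _)) (i2.const_mul _),
      integral_sub iG (i1.const_mul _), hG] at hmono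
    simp only [integral_const_mul] at hmono
    have hVt : V t = (∫ x in (0:ℝ)..L, u x t ^ 2) + ∫ x in (0:ℝ)..L, v x t ^ 2 :=
      integral_add i3 i4
    have n3 : 0 ≤ ∫ x in (0:ℝ)..L, u x t ^ 2 := integral_nonneg hL.le fun _ _ => sq_nonneg _
    have n4 : 0 ≤ ∫ x in (0:ℝ)..L, v x t ^ 2 := integral_nonneg hL.le fun _ _ => sq_nonneg _
    rw [hVt]
    generalize (∫ x in (0:ℝ)..L, u x t ^ 2) = U2 at *
    generalize (∫ x in (0:ℝ)..L, v x t ^ 2) = V2 at *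
    generalize (∫ x in (0:ℝ)..L, ux x t ^ 2) = UX at *
    generalize (∫ x in (0:ℝ)..L, vx x t ^ 2) = VX at *
    generalize (∫ x in (0:ℝ)..L, (2 * u x t * ut x t + 2 * v x t * vt x t)) = T at *
    have hAτ : τ * A = min (Cp * μ / 4) (Cp * D / 4 + 7 * d / 4) := by
      rw [hA]; field_simp
    have m1 : τ * A ≤ Cp * μ / 4 := hAτ ▸ min_le_left _ _
    have m2 : τ * A ≤ Cp * D / 4 + 7 * d / 4 := hAτ ▸ min_le_right _ _
    have r1 := mul_le_mul_of_nonneg_right m1 n3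
    have r2 := mul_le_mul_of_nonneg_right m2 n4
    have r3 := mul_le_mul_of_nonneg_right hcond3 n3
    have r4 := mul_le_mul_of_nonneg_right hcond4 n4
    have r5 := mul_le_mul_of_nonneg_left P1 hμ.le
    have r6 := mul_le_mul_of_nonneg_left P2 hD.le
    refine le_of_mul_le_mul_left ?_ hτ
    linarith
  have hanti : AntitoneOn (fun t => Real.exp (A * t) * V t) (Ici 0) := by
    have hder : ∀ t ∈ Ioi (0:ℝ), HasDerivAt (fun t => Real.exp (A * t) * V t)
        (Real.exp (A * t) * (A * 1) * V t + Real.exp (A * t) *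
          ∫ x in (0:ℝ)..L, (2 * u x t * ut x t + 2 * v x t * vt x t)) t := fun t ht =>
      (((hasDerivAt_id t).const_mul A).exp).mul (hVd t ht)
    apply antitoneOn_of_deriv_nonpos (convex_Ici 0)
    · exact (by fun_prop : Continuous fun t => Real.exp (A * t)).continuousOn.mul hVc
    · rw [interior_Ici]
      exact fun t ht => (hder t ht).differentiableAt.differentiableWithinAt
    · rw [interior_Ici]
      intro t ht
      rw [(hder t ht).deriv]
      have := mul_le_mul_of_nonneg_left (main t ht) (Real.exp_pos (A * t)).le
      linarith
  intro t ht
  have h := hanti (mem_Ici.2 le_rfl) ht ht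
  simp only [mul_zero, Real.exp_zero, one_mul] at h
  have h2 := mul_le_mul_of_nonneg_left h (Real.exp_pos (-A * t)).le
  rw [← mul_assoc, ← Real.exp_add] at h2
  simpa using h2
end
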